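/- arXiv:2602.02764 — 2 statements merged into one kernel-verified Lean document; each statement's English description precedes it below -/
import Mathlib

section
/- Let r ≥ 1 be a natural number, and let n₁, …, n_r ≥ 2 and k₁, …, k_r ≥ 1 be natural numbers satisfying k_{i−1} > 3·5^{2n_i} for all i = 2, 3, …, r. Then the X-word length of the element a^{5^{2n₁}} b^{5^{2n₁}} c^{k₁} ⋯ a^{5^{2n_r}} b^{5^{2n_r}} c^{k_r} of F₃ equals Σ_{i=1}^r k_i + Σ_{i=1}^r (5^{2n_i−1} + 1). -/
/-- `F₃`, the free group on three generators `a, b, c`. -/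
abbrev F3 : Type := FreeGroup (Fin 3)

/-- The generator `a`. -/
def ga : F3 := FreeGroup.of 0
/-- The generator `b`. -/
def gb : F3 := FreeGroup.of 1
/-- The generator `c`. -/
def gc : F3 := FreeGroup.of 2

/-- The standard generating set `S = {a, b, c, a⁻¹, b⁻¹, c⁻¹}`.
The word length `|u|` with respect to `S` is `FreeGroup.norm u`. -/
def Sgen : Set F3 := {ga, gb, gc, ga⁻¹, gb⁻¹, gc⁻¹}

/-- The `T`-word length of `g`: the least `n ≥ 0` such that `g` is a product of
`n` elements of `T` (the identity has length `0`). -/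
noncomputable def wordLen (T : Set F3) (g : F3) : ℕ :=
  sInf {n : ℕ | ∃ l : List F3, (∀ x ∈ l, x ∈ T) ∧ l.prod = g ∧ l.length = n}

/-- `x(v,j) = v b^(5^(2j-1)) v⁻¹ a^(5^(2j)) b^(5^(2j))`. -/
def xgen (v : F3) (j : ℕ) : F3 :=
  v * gb ^ (5 ^ (2 * j - 1)) * v⁻¹ * ga ^ (5 ^ (2 * j)) * gb ^ (5 ^ (2 * j))

/-- `X_∞ = ⋃_{j ≥ 2} X_j` where `X_j = {x(v,j) : |v| ≤ 5^j}`. -/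
def Xinf : Set F3 :=
  ⋃ j ∈ {j : ℕ | 2 ≤ j}, {w : F3 | ∃ v : F3, v.norm ≤ 5 ^ j ∧ w = xgen v j}

/-- The generating set `X = X_∞ ∪ S`. -/
def Xgen : Set F3 := Xinf ∪ Sgen

/-! ### Setup: annotated words -/

/-- Letters of the free group. -/
abbrev Ltr : Type := Fin 3 × Bool

/-- Letter `a`. -/
abbrev lA : Ltr := (0, true)
/-- Letter `b`. -/
abbrev lB : Ltr := (1, true)
/-- Letter `c`. -/
abbrev lC : Ltr := (2, true)

/-- Weight of each letter `b` in a block of index `n`. -/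
def lam (n : ℕ) : ℚ := (5 ^ (2 * n - 1) + 1) / 5 ^ (2 * n)

/-- The target word, each letter annotated with a weight. -/
def GW (n k : ℕ → ℕ) : ℕ → List (Ltr × ℚ)
  | 0 => []
  | r + 1 => GW n k r ++ (List.replicate (5 ^ (2 * n r)) (lA, 0)
      ++ (List.replicate (5 ^ (2 * n r)) (lB, lam (n r)) ++ List.replicate (k r) (lC, 0)))

/-- Total weight. -/
def wt (I : List (Ltr × ℚ)) : ℚ := (I.map Prod.snd).sum

/-- Letters of an annotated word. -/
def lt (I : List (Ltr × ℚ)) : List Ltr := I.map Prod.fst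

@[simp] lemma wt_append (I J : List (Ltr × ℚ)) : wt (I ++ J) = wt I + wt J := by simp [wt]
@[simp] lemma lt_append (I J : List (Ltr × ℚ)) : lt (I ++ J) = lt I ++ lt J := by simp [lt]
@[simp] lemma wt_nil : wt [] = 0 := by simp [wt]
@[simp] lemma lt_nil : lt [] = [] := by simp [lt]
@[simp] lemma wt_cons (x : Ltr × ℚ) (J : List (Ltr × ℚ)) : wt (x :: J) = x.2 + wt J := by simp [wt]
@[simp] lemma lt_cons (x : Ltr × ℚ) (J : List (Ltr × ℚ)) : lt (x :: J) = x.1 :: lt J := by simp [lt]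
@[simp] lemma wt_replicate (m : ℕ) (x : Ltr × ℚ) : wt (List.replicate m x) = m * x.2 := by
  simp [wt]
@[simp] lemma lt_replicate (m : ℕ) (x : Ltr × ℚ) :
    lt (List.replicate m x) = List.replicate m x.1 := by
  simp [lt]
@[simp] lemma length_lt (I : List (Ltr × ℚ)) : (lt I).length = I.length := by simp [lt]

lemma pow_two_sub (n : ℕ) (hn : 2 ≤ n) : 5 ^ (2 * n) = 5 * 5 ^ (2 * n - 1) := by
  rw [← pow_succ']; congr 1; omega

lemma lam_nonneg (n : ℕ) : 0 ≤ lam n := by unfold lam; positivity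

lemma lam_eq (n : ℕ) (hn : 2 ≤ n) : lam n = 1 / 5 + 1 / 5 ^ (2 * n) := by
  have h : (5 : ℚ) ^ (2 * n) = 5 * 5 ^ (2 * n - 1) := by exact_mod_cast pow_two_sub n hn
  have : (5 : ℚ) ^ (2 * n - 1) ≠ 0 := by positivity
  unfold lam; rw [h]; field_simp

lemma lam_le (n : ℕ) (hn : 2 ≤ n) : lam n ≤ 1 / 2 := by
  rw [lam_eq n hn]
  have : (1 : ℚ) / 5 ^ (2 * n) ≤ 1 / 5 := by
    apply one_div_le_one_div_of_le (by norm_num)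
    exact le_self_pow₀ (by norm_num) (by omega)
  linarith

lemma GW_mem (n k : ℕ → ℕ) (r : ℕ) (hn : ∀ i < r, 2 ≤ n i) (x : Ltr × ℚ) (hx : x ∈ GW n k r) :
    0 ≤ x.2 ∧ x.2 ≤ 1 / 2 ∧ x.1.2 = true ∧ (x.1 ≠ lB → x.2 = 0) := by
  induction r with
  | zero => simp [GW] at hx
  | succ r ih =>
    simp only [GW, List.mem_append, List.mem_replicate] at hx
    rcases hx with h | ⟨_, rfl⟩ | ⟨_, rfl⟩ | ⟨_, rfl⟩
    · exact ih (fun i hi => hn i (by omega)) h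
    · simp
    · simpa using ⟨lam_nonneg _, by simpa using lam_le _ (hn r (by omega))⟩
    · simp

lemma wt_nonneg (I : List (Ltr × ℚ)) (h : ∀ x ∈ I, 0 ≤ x.2) : 0 ≤ wt I := by
  induction I with
  | nil => simp
  | cons x I ih =>
    simp only [List.mem_cons, forall_eq_or_imp] at h
    have := ih h.2
    simp only [wt_cons]; linarith [h.1]

lemma wt_le_count (t : ℚ) (I : List (Ltr × ℚ))
    (h : ∀ x ∈ I, x.2 ≤ t ∧ (x.1 ≠ lB → x.2 = 0)) : wt I ≤ t * (lt I).count lB := by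
  induction I with
  | nil => simp
  | cons x I ih =>
    simp only [List.mem_cons, forall_eq_or_imp] at h
    have := ih h.2
    simp only [wt_cons, lt_cons, List.count_cons]
    by_cases hx : x.1 = lB
    · simp only [hx, beq_self_eq_true, if_true]; push_cast; linarith [h.1.1]
    · simp [hx, h.1.2 hx]; linarith

lemma wt_GW (n k : ℕ → ℕ) (r : ℕ) :
    wt (GW n k r) = ∑ i ∈ Finset.range r, ((5 : ℚ) ^ (2 * n i - 1) + 1) := by
  induction r with
  | zero => simp [GW]
  | succ r ih =>
    rw [Finset.sum_range_succ, ← ih]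
    simp only [GW, wt_append, wt_replicate, lam]
    push_cast
    field_simp
    ring

lemma mk_replicate (x : Fin 3) (m : ℕ) :
    (FreeGroup.mk (List.replicate m (x, true)) : F3) = FreeGroup.of x ^ m := by
  rw [← FreeGroup.toWord_of_pow, FreeGroup.mk_toWord]

lemma mk_GW (n k : ℕ → ℕ) (r : ℕ) :
    (FreeGroup.mk (lt (GW n k r)) : F3) = (((List.range r).map
          (fun i => ga ^ (5 ^ (2 * n i)) * gb ^ (5 ^ (2 * n i)) * gc ^ (k i))).prod) := by
  induction r with
  | zero => simp [GW]; rfl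
  | succ r ih =>
    rw [List.range_succ, List.map_append, List.prod_append, ← ih]
    simp only [GW, lt_append, lt_replicate, ← FreeGroup.mul_mk, mk_replicate]
    simp [ga, gb, gc, mul_assoc]

lemma isReduced_of_pos (w : List Ltr) (h : ∀ x ∈ w, x.2 = true) : FreeGroup.IsReduced w := by
  induction w with
  | nil => simp
  | cons x w ih =>
    cases w with
    | nil => simp
    | cons y w =>
      rw [FreeGroup.isReduced_cons_cons]
      refine ⟨fun _ => ?_, ih fun z hz => h z (List.mem_cons_of_mem _ hz)⟩
      rw [h x (by simp), h y (by simp)]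

lemma toWord_GW (n k : ℕ → ℕ) (r : ℕ) (hn : ∀ i < r, 2 ≤ n i) :
    (FreeGroup.mk (lt (GW n k r)) : F3).toWord = lt (GW n k r) := by
  rw [FreeGroup.toWord_mk]
  apply FreeGroup.IsReduced.reduce_eq
  apply isReduced_of_pos
  intro x hx
  simp only [lt, List.mem_map] at hx
  obtain ⟨y, hy, rfl⟩ := hx
  exact (GW_mem n k r hn y hy).2.2.1

/-! ### Longest common prefix -/

/-- Weight of the longest common prefix. -/
def EW : List (Ltr × ℚ) → List Ltr → ℚ
  | (x :: G), (y :: h) => if x.1 = y then x.2 + EW G h else 0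
  | _, _ => 0

lemma EW_spec (G : List (Ltr × ℚ)) (h : List Ltr) :
    ∃ A B u, G = A ++ B ∧ h = lt A ++ u ∧ EW G h = wt A ∧
      (∀ x ∈ (lt B).head?, ∀ y ∈ u.head?, x ≠ y) := by
  induction G generalizing h with
  | nil => exact ⟨[], [], h, by simp [EW]⟩
  | cons x G ih =>
    cases h with
    | nil => exact ⟨[], x :: G, [], by simp [EW]⟩
    | cons y h =>
      by_cases hxy : x.1 = y
      · obtain ⟨A, B, u, h1, h2, h3, h4⟩ := ih h
        exact ⟨x :: A, B, u, by simp [h1], by simp [hxy, h2], by simp [EW, hxy, h3], h4⟩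
      · exact ⟨[], x :: G, y :: h, by simp, by simp, by simp [EW, hxy], by simpa using hxy⟩

lemma EW_self (G : List (Ltr × ℚ)) : EW G (lt G) = wt G := by
  induction G with
  | nil => simp [EW]
  | cons x G ih => simp [EW, ih]

lemma reduced_invRev (u : List Ltr) (hu : FreeGroup.IsReduced u) :
    FreeGroup.IsReduced (FreeGroup.invRev u) := by
  rw [FreeGroup.isReduced_iff_reduce_eq] at *
  rw [FreeGroup.reduce_invRev, hu]

/-- If the potential increases, the increase is realised by a factor of the jump. -/
lemma EW_step (G : List (Ltr × ℚ)) (hG : ∀ x ∈ G, 0 ≤ x.2) (h x : F3) :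
    EW G (h * x).toWord ≤ EW G h.toWord ∨ ∃ A I B U V, G = A ++ I ++ B ∧
      x.toWord = U ++ lt I ++ V ∧ EW G (h * x).toWord = EW G h.toWord + wt I := by
  obtain ⟨A, B, u, hG1, hh, hE, hd⟩ := EW_spec G h.toWord
  obtain ⟨A', B', u', hG2, hh', hE', -⟩ := EW_spec G (h * x).toWord
  have h1 := hG1.symm.trans hG2
  rw [List.append_eq_append_iff] at h1
  rcases h1 with ⟨I, rfl, rfl⟩ | ⟨C, rfl, -⟩
  · by_cases hI : I = []
    · left; simp [hE, hE', hI]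
    right
    refine ⟨A, I, B', FreeGroup.invRev u, u', hG2, ?_, by rw [hE, hE', wt_append]⟩
    have hx : x = FreeGroup.mk (FreeGroup.invRev u ++ lt I ++ u') := by
      have e1 : h = FreeGroup.mk (lt A) * FreeGroup.mk u := by
        rw [FreeGroup.mul_mk, ← hh, FreeGroup.mk_toWord]
      have e2 : h * x = FreeGroup.mk (lt A) * FreeGroup.mk (lt I) * FreeGroup.mk u' := by
        rw [FreeGroup.mul_mk, FreeGroup.mul_mk, ← lt_append, ← hh', FreeGroup.mk_toWord]
      rw [← FreeGroup.mul_mk, ← FreeGroup.mul_mk, ← FreeGroup.inv_mk]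
      rw [eq_comm, ← inv_mul_eq_iff_eq_mul] at e2
      rw [← e2, e1]; group
    conv_lhs => rw [hx]
    rw [FreeGroup.toWord_mk]
    apply FreeGroup.IsReduced.reduce_eq
    have r1 : FreeGroup.IsReduced u :=
      (FreeGroup.isReduced_toWord (x := h)).infix ⟨lt A, [], by simp [hh]⟩
    have r2 : FreeGroup.IsReduced (lt I ++ u') :=
      (FreeGroup.isReduced_toWord (x := h * x)).infix ⟨lt A, [], by simp [hh']⟩
    rw [List.append_assoc]
    refine List.isChain_append.2 ⟨reduced_invRev u r1, r2, ?_⟩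
    obtain ⟨i, I', rfl⟩ := List.exists_cons_of_ne_nil hI
    cases u with
    | nil => simp
    | cons y u =>
      simp at hd
      obtain ⟨y1, y2⟩ := y
      obtain ⟨⟨i1, i2⟩, i3⟩ := i
      simp [FreeGroup.invRev] at hd ⊢
      rintro rfl
      have := hd rfl
      cases i2 <;> cases y2 <;> simp_all
  · left
    rw [hE, hE', wt_append]
    have := wt_nonneg C (fun x hx => hG x (by simp [hG1, hx]))
    linarith

/-! ### The reduced word of a jump -/

lemma strip_tail (z : Ltr) (w : List Ltr) :
    ∃ P p, w = P ++ List.replicate p z ∧ ∀ y ∈ P.getLast?, y ≠ z := by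
  induction w using List.reverseRecOn with
  | nil => exact ⟨[], 0, by simp⟩
  | append_singleton w y ih =>
    by_cases h : y = z
    · obtain ⟨P, p, h1, h2⟩ := ih
      refine ⟨P, p + 1, ?_, h2⟩
      rw [h1, h, List.replicate_succ', List.append_assoc]
    · exact ⟨w ++ [y], 0, by simp, by simpa using h⟩

lemma mk_replicate_inv (x : Fin 3) (m : ℕ) :
    (FreeGroup.mk (List.replicate m (x, false)) : F3) = (FreeGroup.of x ^ m)⁻¹ := by
  rw [← mk_replicate, FreeGroup.inv_mk]
  simp [FreeGroup.invRev]

lemma word_mul (y : F3) (L N : ℕ) (hy : y.norm ≤ L) (hLN : L < N) :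
    ∃ P q, P.length ≤ L ∧ N ≤ q + L ∧
      (y * ga ^ N * gb ^ N).toWord = P ++ List.replicate q lA ++ List.replicate N lB := by
  obtain ⟨P, p, h1, h2⟩ := strip_tail (0, false) y.toWord
  have hlen : P.length + p ≤ L := by
    have := congrArg List.length h1
    simp at this
    unfold FreeGroup.norm at hy
    omega
  refine ⟨P, N - p, by omega, by omega, ?_⟩
  have hP : FreeGroup.IsReduced P :=
    (FreeGroup.isReduced_toWord (x := y)).infix ⟨[], List.replicate p (0, false), by simp [h1]⟩
  have e : y * ga ^ N * gb ^ N
      = FreeGroup.mk (P ++ List.replicate (N - p) lA ++ List.replicate N lB) := by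
    have e1 : y = FreeGroup.mk P * (FreeGroup.of 0 ^ p)⁻¹ := by
      rw [← mk_replicate_inv, FreeGroup.mul_mk, ← h1, FreeGroup.mk_toWord]
    rw [← FreeGroup.mul_mk, ← FreeGroup.mul_mk, mk_replicate, mk_replicate, e1]
    have : (ga ^ N : F3) = FreeGroup.of 0 ^ p * FreeGroup.of 0 ^ (N - p) := by
      rw [← pow_add, ga]; congr 1; omega
    rw [this, gb]; group
  rw [e, FreeGroup.toWord_mk]
  apply FreeGroup.IsReduced.reduce_eq
  rw [List.append_assoc]
  refine List.isChain_append.2 ⟨hP, ?_, ?_⟩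
  · apply isReduced_of_pos
    intro x hx
    simp only [List.mem_append, List.mem_replicate] at hx
    rcases hx with ⟨_, rfl⟩ | ⟨_, rfl⟩ <;> rfl
  · intro x hx z hz
    obtain ⟨m, hm⟩ : ∃ m, N - p = m + 1 := ⟨N - p - 1, by omega⟩
    rw [hm, List.replicate_succ] at hz
    simp at hz
    subst hz
    have := h2 x hx
    obtain ⟨x1, x2⟩ := x
    rintro rfl
    cases x2
    · exact absurd rfl this
    · rfl

lemma xgen_word (v : F3) (j : ℕ) (hj : 2 ≤ j) (hv : v.norm ≤ 5 ^ j) :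
    ∃ P q, P.length ≤ 2 * 5 ^ j + 5 ^ (2 * j - 1) ∧
      5 ^ (2 * j) ≤ q + (2 * 5 ^ j + 5 ^ (2 * j - 1)) ∧
      (xgen v j).toWord = P ++ List.replicate q lA ++ List.replicate (5 ^ (2 * j)) lB := by
  apply word_mul
  · have h1 := FreeGroup.norm_mul_le (v * gb ^ (5 ^ (2 * j - 1))) v⁻¹
    have h2 := FreeGroup.norm_mul_le v (gb ^ (5 ^ (2 * j - 1)))
    rw [FreeGroup.norm_inv_eq] at h1
    have h3 : (gb ^ (5 ^ (2 * j - 1))).norm = 5 ^ (2 * j - 1) := FreeGroup.norm_of_pow _ _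
    omega
  · have h1 := pow_two_sub j hj
    have h2 : 5 ^ (2 * j) = 5 ^ j * 5 ^ j := by rw [← pow_add]; congr 1; omega
    have h3 : 25 ≤ 5 ^ j := by
      calc 25 = 5 ^ 2 := by norm_num
        _ ≤ 5 ^ j := Nat.pow_le_pow_right (by norm_num) hj
    nlinarith

/-! ### Combinatorics of factors -/

lemma tail_unique (x y : Ltr) (hxy : x ≠ y) (Y Z : List Ltr) (s e : ℕ)
    (h : Y ++ x :: List.replicate s y = Z ++ x :: List.replicate e y) : s = e ∧ Y = Z := by
  have key : ∀ (w : List Ltr) (s e : ℕ),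
      x :: List.replicate s y = w ++ x :: List.replicate e y → w = [] := by
    intro w s e hw
    cases w with
    | nil => rfl
    | cons z w =>
      simp at hw
      have : x ∈ List.replicate s y := by rw [hw.2]; simp
      exact absurd (List.eq_of_mem_replicate this) hxy
  rw [List.append_eq_append_iff] at h
  rcases h with ⟨w, rfl, h⟩ | ⟨w, rfl, h⟩
  · have := key w _ _ h
    subst this
    simpa using h
  · have := key w _ _ h
    subst this
    simp at h
    simpa using h.symm

/-- A prefix of the target word that ends in the letter `b`. -/
lemma GW_prefix (n k : ℕ → ℕ) (r : ℕ) (hk : ∀ i < r, 1 ≤ k i)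
    (hsep : ∀ i, 1 ≤ i → i < r → 3 * 5 ^ (2 * n i) < k (i - 1))
    (Z B : List (Ltr × ℚ)) (w : ℚ) (h : Z ++ [(lB, w)] ++ B = GW n k r) :
    ∃ pre i m e, i < r ∧ e ≤ 5 ^ (2 * n i) ∧ (pre = [] ∨ 3 * 5 ^ (2 * n i) < m) ∧
      Z ++ [(lB, w)] = pre ++ (List.replicate m (lC, 0) ++ List.replicate (5 ^ (2 * n i)) (lA, 0)
        ++ List.replicate e (lB, lam (n i))) := by
  induction r generalizing Z B with
  | zero => simp [GW] at h
  | succ r ih =>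
    have hpre : ∃ pre m, GW n k r = pre ++ List.replicate m (lC, (0 : ℚ)) ∧
        (pre = [] ∨ 3 * 5 ^ (2 * n r) < m) := by
      cases r with
      | zero => exact ⟨[], 0, by simp [GW]⟩
      | succ r =>
        refine ⟨GW n k r ++ List.replicate (5 ^ (2 * n r)) (lA, 0) ++
          List.replicate (5 ^ (2 * n r)) (lB, lam (n r)), k r, ?_, Or.inr (hsep (r + 1) (by omega) (by omega))⟩
        simp [GW]
    rw [GW, List.append_eq_append_iff] at h
    rcases h with ⟨t, h1, h2⟩ | ⟨t, h1, h2⟩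
    · obtain ⟨pre, i, m, e, hi, h3⟩ := ih (fun i hi => hk i (by omega))
        (fun i hi hi' => hsep i hi (by omega)) Z t h1.symm
      exact ⟨pre, i, m, e, by omega, h3⟩
    · obtain ⟨pre, m, hp, hm⟩ := hpre
      rcases List.eq_nil_or_concat t with rfl | ⟨t', x, rfl⟩
      · have : Z ++ [(lB, w)] ++ [] = GW n k r := by simp [h1]
        obtain ⟨pre, i, m, e, hi, h3⟩ := ih (fun i hi => hk i (by omega))
          (fun i hi hi' => hsep i hi (by omega)) Z [] this
        exact ⟨pre, i, m, e, by omega, h3⟩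
      rw [List.concat_eq_append] at h1 h2
      have hx : x = (lB, w) := by
        rw [← List.append_assoc] at h1
        simpa using (List.append_inj_right' h1 (by rfl)).symm
      subst hx
      rw [← List.append_assoc, eq_comm, List.append_eq_append_iff] at h2
      rcases h2 with ⟨u, h2, h3⟩ | ⟨u, h2, h3⟩
      swap
      · -- the prefix ends at or beyond the end of the run of letters b
        have hu : u = [] := by
          rcases List.eq_nil_or_concat u with rfl | ⟨u', y, rfl⟩
          · rfl
          · rw [List.concat_eq_append, ← List.append_assoc] at h2
            have hy : y = (lB, w) := by simpa using (List.append_inj_right' h2 (by rfl)).symm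
            have : y ∈ List.replicate (k r) (lC, (0 : ℚ)) := by rw [h3]; simp
            have := List.eq_of_mem_replicate this
            rw [hy] at this
            simp [lB, lC] at this
        subst hu
        refine ⟨pre, r, m, 5 ^ (2 * n r), by omega, le_rfl, hm, ?_⟩
        rw [h1, h2, hp]; simp
      · rw [List.append_eq_append_iff] at h2
        rcases h2 with ⟨s, h4, h5⟩ | ⟨s, h4, h5⟩
        swap
        · have : (lB, w) ∈ List.replicate (5 ^ (2 * n r)) (lA, (0 : ℚ)) := by rw [h4]; simp
          have := List.eq_of_mem_replicate this
          simp [lA, lB] at this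
        · obtain ⟨e, rfl⟩ : ∃ e, s = List.replicate e (lB, lam (n r)) :=
            ⟨s.length, List.eq_replicate_iff.2 ⟨rfl, fun b hb =>
              List.eq_of_mem_replicate (n := 5 ^ (2 * n r)) (by rw [h5]; simp [hb])⟩⟩
          refine ⟨pre, r, m, e, by omega, ?_, hm, ?_⟩
          · have := congrArg List.length h5
            simp at this; omega
          · rw [h1, h4, hp]; simp

lemma arith_big (j q N k : ℕ) (hj : 2 ≤ j)
    (h1 : 5 ^ (2 * j) ≤ q + (2 * 5 ^ j + 5 ^ (2 * j - 1))) (hq : q ≤ N) (hk : 3 * N < k)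
    (hkL : k ≤ 2 * 5 ^ j + 5 ^ (2 * j - 1)) : False := by
  have h1 := pow_two_sub j hj
  have h2 : 5 ^ (2 * j) = 5 ^ j * 5 ^ j := by rw [← pow_add]; congr 1; omega
  have h3 : 25 ≤ 5 ^ j := by
    calc 25 = 5 ^ 2 := by norm_num
      _ ≤ 5 ^ j := Nat.pow_le_pow_right (by norm_num) hj
  nlinarith

lemma arith_pos (j q : ℕ) (hj : 2 ≤ j)
    (h1 : 5 ^ (2 * j) ≤ q + (2 * 5 ^ j + 5 ^ (2 * j - 1))) : 1 ≤ q := by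
  by_contra h
  have h2 := pow_two_sub j hj
  have h3 : 5 ^ (2 * j) = 5 ^ j * 5 ^ j := by rw [← pow_add]; congr 1; omega
  have h4 : 25 ≤ 5 ^ j := by
    calc 25 = 5 ^ 2 := by norm_num
      _ ≤ 5 ^ j := Nat.pow_le_pow_right (by norm_num) hj
  have h5 : q = 0 := by omega
  subst h5
  nlinarith

lemma arith_small (j : ℕ) (hj : 2 ≤ j) :
    2 * 5 ^ j + 5 ^ (2 * j - 1) ≤ 2 * 5 ^ (2 * j - 1) := by
  have h1 := pow_two_sub j hj
  have h2 : 5 ^ (2 * j) = 5 ^ j * 5 ^ j := by rw [← pow_add]; congr 1; omega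
  have h3 : 25 ≤ 5 ^ j := by
    calc 25 = 5 ^ 2 := by norm_num
      _ ≤ 5 ^ j := Nat.pow_le_pow_right (by norm_num) hj
  nlinarith

lemma arith_lam (d i j : ℕ) (hi : 2 ≤ i) (hj : 2 ≤ j) (h1 : d ≤ 5 ^ (2 * i))
    (h2 : d ≤ 5 ^ (2 * j)) : lam i * d ≤ 5 ^ (2 * j - 1) + 1 := by
  rw [pow_two_sub j hj] at h2
  rw [lam_eq i hi, add_mul]
  have h2' : (d : ℚ) ≤ 5 * 5 ^ (2 * j - 1) := by exact_mod_cast h2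
  have h1' : (d : ℚ) ≤ 5 ^ (2 * i) := by exact_mod_cast h1
  have : (1 : ℚ) / 5 ^ (2 * i) * d ≤ 1 := by
    rw [one_div_mul_eq_div, div_le_one (by positivity)]; exact h1'
  linarith

/-- A common suffix of `Q = c^m a^N b^e` and `P a^q b^s` contains at most `min e s` letters `b`. -/
lemma count_suffix (U I T P : List Ltr) (q s m N e : ℕ) (hq : 1 ≤ q) (hN : 1 ≤ N)
    (h1 : U ++ I = P ++ List.replicate q lA ++ List.replicate s lB)
    (h2 : T ++ I = List.replicate m lC ++ List.replicate N lA ++ List.replicate e lB) :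
    I.count lB ≤ s ∧ I.count lB ≤ e := by
  have he : I.count lB ≤ e := by
    have := congrArg (List.count lB) h2
    simp [List.count_replicate] at this
    omega
  refine ⟨?_, he⟩
  by_cases hl : I.length ≤ s
  · exact List.count_le_length.trans hl
  obtain ⟨q, rfl⟩ := Nat.exists_eq_add_of_le' hq
  obtain ⟨N, rfl⟩ := Nat.exists_eq_add_of_le' hN
  rw [List.replicate_succ'] at h1 h2
  have h1' : U ++ I = (P ++ List.replicate q lA) ++ (lA :: List.replicate s lB) := by
    simpa using h1
  have h2' : T ++ I = (List.replicate m lC ++ List.replicate N lA) ++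
      (lA :: List.replicate e lB) := by
    simpa using h2
  rw [List.append_eq_append_iff] at h1'
  rcases h1' with ⟨t, h3, h4⟩ | ⟨t, h3, h4⟩
  · rw [h4, ← List.append_assoc] at h2'
    have := (tail_unique lA lB (by decide) _ _ _ _ h2').1
    omega
  · have := congrArg List.length h4
    simp at this
    have ht : t = [] := by
      apply List.eq_nil_of_length_eq_zero
      omega
    subst ht
    simp only [List.nil_append] at h4
    rw [← h4] at h2'
    have := (tail_unique lA lB (by decide) _ _ _ _ h2').1
    omega

/-- A suffix of `P a^q b^s` that contains a full `c^m a^N b^e`. -/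
lemma full_suffix (U P : List Ltr) (q s m N e : ℕ) (hq : 1 ≤ q) (hN : 1 ≤ N) (hm : 1 ≤ m)
    (h1 : U ++ (List.replicate m lC ++ List.replicate N lA ++ List.replicate e lB)
      = P ++ List.replicate q lA ++ List.replicate s lB) :
    q ≤ N ∧ m ≤ P.length := by
  have hc : m ≤ P.length := by
    have := congrArg (List.count lC) h1
    simp [List.count_replicate] at this
    have h := List.count_le_length (a := lC) (l := P)
    omega
  refine ⟨?_, hc⟩
  obtain ⟨q, rfl⟩ := Nat.exists_eq_add_of_le' hq
  obtain ⟨N, rfl⟩ := Nat.exists_eq_add_of_le' hN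
  obtain ⟨m, rfl⟩ := Nat.exists_eq_add_of_le' hm
  rw [List.replicate_succ' (a := lA), List.replicate_succ' (a := lA),
    List.replicate_succ' (a := lC)] at h1
  have h2 : (U ++ List.replicate m lC ++ lC :: List.replicate N lA) ++ lA :: List.replicate e lB
      = (P ++ List.replicate q lA) ++ lA :: List.replicate s lB := by simpa using h1
  have h3 := (tail_unique lA lB (by decide) _ _ _ _ h2).2
  rw [List.append_eq_append_iff] at h3
  rcases h3 with ⟨t, h4, h5⟩ | ⟨t, h4, h5⟩
  · cases t with
    | nil =>
      have : lC ∈ List.replicate q lA := by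
        rw [List.nil_append] at h5; rw [← h5]; simp
      exact absurd (List.eq_of_mem_replicate this) (by decide)
    | cons x t =>
      have := congrArg List.length h5
      simp at this
      omega
  · have : lC ∈ List.replicate q lA := by rw [h5]; simp
    exact absurd (List.eq_of_mem_replicate this) (by decide)

/-- The key estimate: a factor of the target word occurring in a jump of index `j`
has weight at most `5^(2j-1) + 1`. -/
lemma key (n k : ℕ → ℕ) (r : ℕ) (hn : ∀ i < r, 2 ≤ n i) (hk : ∀ i < r, 1 ≤ k i)
    (hsep : ∀ i, 1 ≤ i → i < r → 3 * 5 ^ (2 * n i) < k (i - 1))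
    (j : ℕ) (hj : 2 ≤ j) (v : F3) (hv : v.norm ≤ 5 ^ j)
    (A I B : List (Ltr × ℚ)) (U V : List Ltr) (hG : GW n k r = A ++ I ++ B)
    (hx : (xgen v j).toWord = U ++ lt I ++ V) : wt I ≤ 5 ^ (2 * j - 1) + 1 := by
  obtain ⟨P, q, hP, hq, hw⟩ := xgen_word v j hj hv
  have hq1 := arith_pos j q hj hq
  rw [hw] at hx
  have hGm := GW_mem n k r hn
  -- the easy case
  have easy : ∀ t, P ++ List.replicate q lA = U ++ lt I ++ t → wt I ≤ 5 ^ (2 * j - 1) + 1 := by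
    intro t ht
    have hc : (lt I).count lB ≤ 2 * 5 ^ (2 * j - 1) := by
      have := congrArg (List.count lB) ht
      simp [List.count_replicate] at this
      have h := List.count_le_length (a := lB) (l := P)
      have := arith_small j hj
      omega
    have h := wt_le_count (1 / 2) I (fun x hx => by
      have := hGm x (by simp [hG, hx])
      exact ⟨this.2.1, this.2.2.2⟩)
    have hc' : ((lt I).count lB : ℚ) ≤ 2 * 5 ^ (2 * j - 1) := by exact_mod_cast hc
    linarith
  rw [List.append_eq_append_iff] at hx
  rcases hx with ⟨t, h1, h2⟩ | ⟨t, h1, h2⟩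
  swap
  · exact easy t h1
  obtain ⟨s, hs, rfl⟩ : ∃ s, s ≤ 5 ^ (2 * j) ∧ t = List.replicate s lB := by
    refine ⟨t.length, ?_, List.eq_replicate_iff.2 ⟨rfl, fun b hb =>
              List.eq_of_mem_replicate (n := 5 ^ (2 * j)) (by rw [h2]; simp [hb])⟩⟩
    have := congrArg List.length h2
    simp at this; omega
  rcases Nat.eq_zero_or_pos s with rfl | hs0
  · exact easy [] (by simpa using h1.symm)
  rcases List.eq_nil_or_concat I with rfl | ⟨I', x, hI'⟩
  · simp; positivity
  rw [List.concat_eq_append] at hI'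
  have hxB : x.1 = lB := by
    obtain ⟨s, rfl⟩ := Nat.exists_eq_add_of_le' hs0
    rw [hI', List.replicate_succ', lt_append, ← List.append_assoc, ← List.append_assoc] at h1
    simpa using List.append_inj_right' h1 (by simp)
  obtain ⟨pre, i, m, e, hi, he, hpm, hZ⟩ := GW_prefix n k r hk hsep (A ++ I') B x.2 (by
    rw [hG, hI', ← hxB]; simp)
  have hZ' : A ++ I = pre ++ (List.replicate m (lC, 0) ++ List.replicate (5 ^ (2 * n i)) (lA, 0)
        ++ List.replicate e (lB, lam (n i))) := by
    rw [← hZ, hI', ← hxB]; simp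
  have hN1 : 1 ≤ 5 ^ (2 * n i) := Nat.one_le_pow _ _ (by norm_num)
  have main : ∀ T, List.replicate m (lC, (0 : ℚ)) ++ List.replicate (5 ^ (2 * n i)) (lA, (0 : ℚ))
        ++ List.replicate e (lB, lam (n i)) = T ++ I → wt I ≤ 5 ^ (2 * j - 1) + 1 := by
    intro T hT
    have h3 : lt T ++ lt I = List.replicate m lC ++ List.replicate (5 ^ (2 * n i)) lA
        ++ List.replicate e lB := by
      rw [← lt_append, ← hT]; simp
    obtain ⟨c1, c2⟩ := count_suffix U (lt I) (lt T) P q s m _ e hq1 hN1 h1 h3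
    have h := wt_le_count (lam (n i)) I (fun y hy => by
      have : y ∈ T ++ I := by simp [hy]
      rw [← hT] at this
      simp only [List.mem_append, List.mem_replicate] at this
      rcases this with (⟨_, rfl⟩ | ⟨_, rfl⟩) | ⟨_, rfl⟩
      · simp [lam_nonneg]
      · simp [lam_nonneg]
      · simp)
    exact h.trans (arith_lam _ _ _ (hn i hi) hj (c2.trans he) (c1.trans hs))
  rw [List.append_eq_append_iff] at hZ'
  rcases hZ' with ⟨t, h3, h4⟩ | ⟨t, h3, h4⟩
  swap
  · exact main t h4
  rcases hpm with rfl | hm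
  · have : t = [] := by
      have := congrArg List.length h3
      simp at this; exact List.eq_nil_of_length_eq_zero (by omega)
    subst this
    exact main [] (by simpa using h4.symm)
  exfalso
  rw [h4] at h1
  have h5 : (U ++ lt t) ++ (List.replicate m lC ++ List.replicate (5 ^ (2 * n i)) lA
      ++ List.replicate e lB) = P ++ List.replicate q lA ++ List.replicate s lB := by
    rw [← h1]; simp
  obtain ⟨c1, c2⟩ := full_suffix _ P q s m _ e hq1 hN1 (by omega) h5
  exact arith_big j q _ m hj hq c1 hm (c2.trans hP)

/-! ### The potential -/

/-- The homomorphism `exp_a - exp_b + exp_c`. -/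
def exHom : F3 →* Multiplicative ℤ :=
  FreeGroup.lift ![Multiplicative.ofAdd 1, Multiplicative.ofAdd (-1), Multiplicative.ofAdd 1]

/-- Additive form of `exHom`. -/
def ex (h : F3) : ℤ := Multiplicative.toAdd (exHom h)

lemma ex_mul (g h : F3) : ex (g * h) = ex g + ex h := by simp [ex]
lemma ex_inv (g : F3) : ex g⁻¹ = - ex g := by simp [ex]
lemma ex_one : ex 1 = 0 := by simp [ex]
lemma ex_pow (g : F3) (m : ℕ) : ex (g ^ m) = m * ex g := by simp [ex]
lemma ex_ga : ex ga = 1 := by simp [ex, exHom, ga]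
lemma ex_gb : ex gb = -1 := by simp [ex, exHom, gb]
lemma ex_gc : ex gc = 1 := by simp [ex, exHom, gc]

lemma ex_xgen (v : F3) (j : ℕ) : ex (xgen v j) = - 5 ^ (2 * j - 1) := by
  simp only [xgen, ex_mul, ex_inv, ex_pow, ex_ga, ex_gb]
  push_cast
  ring

lemma ex_target (n k : ℕ → ℕ) (r : ℕ) :
    ex (((List.range r).map
          (fun i => ga ^ (5 ^ (2 * n i)) * gb ^ (5 ^ (2 * n i)) * gc ^ (k i))).prod)
      = ∑ i ∈ Finset.range r, (k i : ℤ) := by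
  induction r with
  | zero => simp [ex_one]
  | succ r ih =>
    rw [List.range_succ, List.map_append, List.prod_append, ex_mul, ih, Finset.sum_range_succ]
    simp [ex_mul, ex_pow, ex_ga, ex_gb, ex_gc]

/-- One step of the path increases the potential by at most one. -/
lemma pot_step (n k : ℕ → ℕ) (r : ℕ) (hn : ∀ i < r, 2 ≤ n i) (hk : ∀ i < r, 1 ≤ k i)
    (hsep : ∀ i, 1 ≤ i → i < r → 3 * 5 ^ (2 * n i) < k (i - 1))
    (h x : F3) (hx : x ∈ Xgen) :
    (ex (h * x) : ℚ) + EW (GW n k r) (h * x).toWord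
      ≤ (ex h : ℚ) + EW (GW n k r) h.toWord + 1 := by
  have hGm := GW_mem n k r hn
  rw [ex_mul]
  push_cast
  have step := EW_step (GW n k r) (fun y hy => (hGm y hy).1) h x
  rcases hx with hx | hx
  · simp only [Xinf, Set.mem_iUnion, Set.mem_setOf_eq] at hx
    obtain ⟨j, hj, v, hv, rfl⟩ := hx
    have e : (ex (xgen v j) : ℚ) = - 5 ^ (2 * j - 1) := by rw [ex_xgen]; push_cast; ring
    rw [e]
    rcases step with h1 | ⟨A, I, B, U, V, h1, h2, h3⟩
    · have : (0 : ℚ) ≤ 5 ^ (2 * j - 1) := by positivity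
      linarith
    · have := key n k r hn hk hsep j hj v hv A I B U V h1 h2
      linarith
  · -- a single letter
    have hlet : ∃ l : Ltr, x.toWord = [l] ∧ ((l = lB ∧ ex x = -1) ∨ (l ≠ lB ∧ ex x ≤ 1)) := by
      simp only [Sgen, Set.mem_insert_iff, Set.mem_singleton_iff] at hx
      rcases hx with rfl | rfl | rfl | rfl | rfl | rfl
      · exact ⟨lA, by simp [ga], by simp [ex_ga]⟩
      · exact ⟨lB, by simp [gb], by simp [ex_gb]⟩
      · exact ⟨lC, by simp [gc], by simp [ex_gc]⟩
      · exact ⟨(0, false), by simp [ga, FreeGroup.toWord_inv, FreeGroup.invRev],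
          by simp [ex_inv, ex_ga]⟩
      · exact ⟨(1, false), by simp [gb, FreeGroup.toWord_inv, FreeGroup.invRev],
          by simp [ex_inv, ex_gb]⟩
      · exact ⟨(2, false), by simp [gc, FreeGroup.toWord_inv, FreeGroup.invRev],
          by simp [ex_inv, ex_gc]⟩
    obtain ⟨l, hl, hl'⟩ := hlet
    have hex : (ex x : ℚ) ≤ 1 := by
      have : ex x ≤ 1 := by rcases hl' with h | h <;> omega
      exact_mod_cast this
    rcases step with h1 | ⟨A, I, B, U, V, h1, h2, h3⟩
    · linarith
    · have hI := wt_le_count (1 / 2) I (fun y hy => by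
        have := hGm y (by simp [h1, hy])
        exact ⟨this.2.1, this.2.2.2⟩)
      have hc : (lt I).count lB ≤ [l].count lB := by
        rw [← hl, h2]; simp; omega
      rcases hl' with ⟨rfl, h4⟩ | ⟨h4, h5⟩
      · have hc' : ((lt I).count lB : ℚ) ≤ 1 := by exact_mod_cast (by simpa using hc)
        rw [h4]; push_cast; linarith
      · have hc' : (lt I).count lB = 0 := by
          simp [List.count_singleton, h4] at hc
          simpa using hc
        rw [hc'] at hI
        push_cast at hI
        linarith

lemma pot_path (n k : ℕ → ℕ) (r : ℕ) (hn : ∀ i < r, 2 ≤ n i) (hk : ∀ i < r, 1 ≤ k i)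
    (hsep : ∀ i, 1 ≤ i → i < r → 3 * 5 ^ (2 * n i) < k (i - 1))
    (l : List F3) (hl : ∀ x ∈ l, x ∈ Xgen) (h : F3) :
    (ex (h * l.prod) : ℚ) + EW (GW n k r) (h * l.prod).toWord
      ≤ (ex h : ℚ) + EW (GW n k r) h.toWord + l.length := by
  induction l generalizing h with
  | nil => simp
  | cons x l ih =>
    simp only [List.mem_cons, forall_eq_or_imp] at hl
    have h1 := ih hl.2 (h * x)
    have h2 := pot_step n k r hn hk hsep h x hl.1
    rw [List.prod_cons, ← mul_assoc, List.length_cons]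
    push_cast
    linarith

/-- An explicit short expression of the target. -/
lemma upper (n k : ℕ → ℕ) (r : ℕ) (hn : ∀ i < r, 2 ≤ n i) :
    ∃ l : List F3, (∀ x ∈ l, x ∈ Xgen) ∧ l.prod = (((List.range r).map
          (fun i => ga ^ (5 ^ (2 * n i)) * gb ^ (5 ^ (2 * n i)) * gc ^ (k i))).prod) ∧
      l.length = (∑ i ∈ Finset.range r, k i)
        + ∑ i ∈ Finset.range r, (5 ^ (2 * n i - 1) + 1) := by
  induction r with
  | zero => exact ⟨[], by simp⟩
  | succ r ih =>
    obtain ⟨l, h1, h2, h3⟩ := ih (fun i hi => hn i (by omega))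
    refine ⟨l ++ (List.replicate (5 ^ (2 * n r - 1)) gb⁻¹ ++ (xgen 1 (n r) ::
      List.replicate (k r) gc)), ?_, ?_, ?_⟩
    · intro x hx
      simp only [List.mem_append, List.mem_cons, List.mem_replicate] at hx
      rcases hx with hx | ⟨_, rfl⟩ | rfl | ⟨_, rfl⟩
      · exact h1 x hx
      · right; simp [Sgen]
      · left
        simp only [Xinf, Set.mem_iUnion, Set.mem_setOf_eq]
        exact ⟨n r, hn r (by omega), 1, by simp, rfl⟩
      · right; simp [Sgen]
    · rw [List.range_succ, List.map_append, List.prod_append, List.prod_append, h2]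
      simp [xgen, mul_assoc]
    · rw [List.length_append, h3, Finset.sum_range_succ, Finset.sum_range_succ]
      simp
      ring

/-- Proposition 3.8: for `n₁, …, n_r ≥ 2` and `k₁, …, k_r ≥ 1` with
`k_{i-1} > 3·5^(2 n_i)` for `i = 2, …, r`, we have
`|a^(5^(2n₁)) b^(5^(2n₁)) c^(k₁) ⋯ a^(5^(2n_r)) b^(5^(2n_r)) c^(k_r)|_X
  = Σ k_i + Σ (5^(2n_i - 1) + 1)`.
(Indices are shifted: `i = 0, …, r-1` here corresponds to `i = 1, …, r` in the paper.) -/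
theorem wordLen_prod (r : ℕ) (hr : 1 ≤ r) (n k : ℕ → ℕ)
    (hn : ∀ i < r, 2 ≤ n i) (hk : ∀ i < r, 1 ≤ k i)
    (hsep : ∀ i, 1 ≤ i → i < r → 3 * 5 ^ (2 * n i) < k (i - 1)) :
    wordLen Xgen
        (((List.range r).map
          (fun i => ga ^ (5 ^ (2 * n i)) * gb ^ (5 ^ (2 * n i)) * gc ^ (k i))).prod)
      = (∑ i ∈ Finset.range r, k i)
        + ∑ i ∈ Finset.range r, (5 ^ (2 * n i - 1) + 1) := by 
  apply le_antisymm
  · exact Nat.sInf_le (upper n k r hn)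
  · unfold wordLen
    refine le_csInf (Set.nonempty_of_mem (x := _) (upper n k r hn)) ?_
    rintro m ⟨l, hl, hp, rfl⟩
    have h := pot_path n k r hn hk hsep l hl 1
    rw [one_mul, hp, ex_target, ← mk_GW, toWord_GW n k r hn, EW_self, wt_GW, ex_one,
      FreeGroup.toWord_one] at h
    have h0 : EW (GW n k r) [] = 0 := by cases GW n k r <;> rfl
    rw [h0] at h
    push_cast at h
    have : (((∑ i ∈ Finset.range r, k i)
        + ∑ i ∈ Finset.range r, (5 ^ (2 * n i - 1) + 1) : ℕ) : ℚ) ≤ (l.length : ℚ) := by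
      push_cast
      linarith
    exact_mod_cast this
end

section
/- Let r ≥ 1 be a natural number, and let n₁, …, n_r ≥ 2 and k₁, …, k_r ≥ 1 be natural numbers satisfying k_{i−1} > 3·5^{2n_i} for all i = 2, 3, …, r. Then the X-word length is additive over the factorization a^{5^{2n₁}} b^{5^{2n₁}} c^{k₁} ⋯ a^{5^{2n_r}} b^{5^{2n_r}} c^{k_r}, i.e. |a^{5^{2n₁}} b^{5^{2n₁}} c^{k₁} ⋯ a^{5^{2n_r}} b^{5^{2n_r}} c^{k_r}|_X = Σ_{i=1}^r |a^{5^{2n_i}} b^{5^{2n_i}}|_X + Σ_{i=1}^r |c^{k_i}|_X. -/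
open FreeGroup in
/-- Weighted length of the common prefix of the weighted word `W` and the word `L`. -/
def corrL : List ((Fin 3 × Bool) × ℚ) → List (Fin 3 × Bool) → ℚ
  | p :: W, y :: L => if p.1 = y then p.2 + corrL W L else 0
  | [], _ => 0
  | _ :: _, [] => 0

@[simp] theorem corrL_nil_left (L : List (Fin 3 × Bool)) : corrL [] L = 0 := by simp [corrL]
@[simp] theorem corrL_nil_right (W : List ((Fin 3 × Bool) × ℚ)) : corrL W [] = 0 := by
  cases W <;> simp [corrL]

theorem corrL_append_eq (W1 W2 : List ((Fin 3 × Bool) × ℚ)) (Z : List (Fin 3 × Bool)) :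
    corrL (W1 ++ W2) (W1.map Prod.fst ++ Z) = (W1.map Prod.snd).sum + corrL W2 Z := by
  induction W1 with
  | nil => simp
  | cons p W ih => simp [corrL, ih, add_assoc]

theorem corrL_step (W : List ((Fin 3 × Bool) × ℚ)) (L : List (Fin 3 × Bool)) (s : Fin 3 × Bool) :
    corrL W (L ++ [s]) = corrL W L ∨ ∃ W1 d W2, W = W1 ++ (s, d) :: W2 ∧ L = W1.map Prod.fst ∧
      corrL W (L ++ [s]) = corrL W L + d := by
  induction L generalizing W with
  | nil =>
    cases W with
    | nil => simp
    | cons p W =>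
      by_cases h : p.1 = s
      · right
        exact ⟨[], p.2, W, by simp [← h], rfl, by simp [corrL, h]⟩
      · left; simp [corrL, h]
  | cons y L ih =>
    cases W with
    | nil => simp
    | cons p W =>
      by_cases h : p.1 = y
      · rcases ih W with h1 | ⟨W1, d, W2, h1, h2, h3⟩
        · left; simp [corrL, h, h1]
        · right
          refine ⟨p :: W1, d, W2, by simp [h1], by simp [h, h2], ?_⟩
          simp [corrL, h, h3, add_assoc]
      · left; simp [corrL, h]

/-- If `A` leaves the word `W`, whatever follows does not matter. -/
theorem corrL_off (W : List ((Fin 3 × Bool) × ℚ)) (hW : ∀ p ∈ W, p.1.2 = true)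
    (A Z Z' : List (Fin 3 × Bool)) (i : Fin 3) :
    corrL W (A ++ (i, false) :: Z) = corrL W (A ++ (i, false) :: Z') := by
  induction A generalizing W with
  | nil =>
    cases W with
    | nil => simp
    | cons p W =>
      have h : p.1 ≠ (i, false) := by
        intro h
        have := hW p (by simp)
        simp [h] at this
      simp [corrL, h]
  | cons y A ih =>
    cases W with
    | nil => simp
    | cons p W =>
      have := ih W (fun q hq => hW q (by simp [hq]))
      simp [corrL, this]

theorem corrL_zero (W1 W2 : List ((Fin 3 × Bool) × ℚ)) (h0 : ∀ p ∈ W1, p.2 = 0)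
    (Z : List (Fin 3 × Bool)) (hZ : Z.length ≤ W1.length) : corrL (W1 ++ W2) Z = 0 := by
  induction W1 generalizing Z with
  | nil => simp at hZ; simp [hZ]
  | cons p W ih =>
    cases Z with
    | nil => simp
    | cons y Z =>
      have h1 := ih (fun q hq => h0 q (by simp [hq])) Z (by simpa using hZ)
      have h2 := h0 p (by simp)
      simp [corrL, h1, h2]

theorem corrL_replicate (W2 : List ((Fin 3 × Bool) × ℚ)) (s : Fin 3 × Bool) (d : ℚ) (N t : ℕ)
    (h2 : ∀ p ∈ W2.head?, p.1 ≠ s) :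
    corrL (List.replicate N (s, d) ++ W2) (List.replicate t s) = d * (min N t : ℕ) := by
  induction N generalizing t with
  | zero =>
    cases t with
    | zero => simp
    | succ t =>
      cases W2 with
      | nil => simp
      | cons p W2 =>
        have := h2 p (by simp)
        simp [List.replicate_succ, corrL, this]
  | succ N ih =>
    cases t with
    | zero => simp
    | succ t =>
      rw [List.replicate_succ, List.replicate_succ, List.cons_append]
      simp only [corrL, ih, if_true]
      rw [Nat.succ_min_succ]; push_cast; ring

theorem toWord_step (g : F3) (i : Fin 3) (b : Bool) :
    (g * FreeGroup.mk [(i, b)]).toWord = g.toWord ++ [(i, b)] ∨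
    g.toWord = (g * FreeGroup.mk [(i, b)]).toWord ++ [(i, !b)] := by
  have hred : FreeGroup.IsReduced g.toWord := FreeGroup.isReduced_toWord
  have hg : g = FreeGroup.mk g.toWord := FreeGroup.mk_toWord.symm
  by_cases h : g.toWord.getLast? = some (i, !b)
  · right
    obtain ⟨L', hL'⟩ := List.getLast?_eq_some_iff.1 h
    have : g * FreeGroup.mk [(i, b)] = FreeGroup.mk L' := by
      rw [hg, hL', FreeGroup.mul_mk]
      apply Quot.sound
      have := @FreeGroup.Red.Step.not _ L' [] i (!b)
      simpa using this
    rw [this, FreeGroup.toWord_mk, FreeGroup.IsReduced.reduce_eq, hL']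
    exact hred.infix ⟨[], [(i, !b)], by simp [hL']⟩
  · left
    have h2 : g * FreeGroup.mk [(i, b)] = FreeGroup.mk (g.toWord ++ [(i, b)]) := by
      conv_lhs => rw [hg]
      rw [FreeGroup.mul_mk]
    rw [h2, FreeGroup.toWord_mk, FreeGroup.IsReduced.reduce_eq]
    refine List.IsChain.append hred (List.isChain_singleton _) ?_
    rintro ⟨x, c⟩ hx y hy hxy
    simp at hy
    subst hy
    simp only at hxy ⊢
    subst hxy
    by_contra hc
    apply h
    rw [Option.mem_def] at hx
    rw [hx]
    have hcb : c = !b := by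
      clear hx h2 h hg hred
      cases b <;> cases c <;> simp at hc ⊢
    rw [hcb]

/-- Multiplying on the right by a short element keeps an initial part of the word. -/
theorem toWord_keep (h : F3) (g : F3) (A Z : List (Fin 3 × Bool)) (hg : g.toWord = A ++ Z)
    (hl : h.norm ≤ Z.length) : ∃ Z', (g * h).toWord = A ++ Z' ∧ Z'.length ≤ Z.length + h.norm := by
  have key : ∀ (L : List (Fin 3 × Bool)) (g : F3) (Z : List (Fin 3 × Bool)), g.toWord = A ++ Z →
      L.length ≤ Z.length → ∃ Z', (g * FreeGroup.mk L).toWord = A ++ Z' ∧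
        Z'.length ≤ Z.length + L.length := by
    intro L
    induction L with
    | nil => intro g Z h1 h2; exact ⟨Z, by simpa [← FreeGroup.one_eq_mk] using h1, by simp⟩
    | cons s L ih =>
      intro g Z h1 h2
      have e : g * FreeGroup.mk (s :: L) = (g * FreeGroup.mk [s]) * FreeGroup.mk L := by
        rw [mul_assoc, FreeGroup.mul_mk]; rfl
      rw [e]
      obtain ⟨i, b⟩ := s
      simp only [List.length_cons] at h2
      rcases toWord_step g i b with h | h
      · obtain ⟨Z', h3, h4⟩ := ih (g * FreeGroup.mk [(i, b)]) (Z ++ [(i, b)])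
          (by rw [h, h1]; simp) (by simp; omega)
        refine ⟨Z', h3, ?_⟩
        simp at h4 ⊢; omega
      · rcases List.eq_nil_or_concat Z with rfl | ⟨Z1, z, rfl⟩
        · simp at h2
        · rw [h1] at h
          have h5 : (g * FreeGroup.mk [(i, b)]).toWord = A ++ Z1 := by
            rw [List.concat_eq_append, ← List.append_assoc] at h
            exact (List.append_inj' h rfl).1.symm
          simp at h2
          obtain ⟨Z', h3, h4⟩ := ih (g * FreeGroup.mk [(i, b)]) Z1 h5 (by omega)
          refine ⟨Z', h3, ?_⟩
          simp; omega
  obtain ⟨Z', h1, h2⟩ := key h.toWord g Z hg hl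
  rw [FreeGroup.mk_toWord] at h1
  exact ⟨Z', h1, h2⟩

/-- The conditions on the weights. -/
def GoodW (W : List ((Fin 3 × Bool) × ℚ)) : Prop :=
  ∀ p ∈ W, p.1.2 = true ∧ 0 ≤ p.2 ∧ p.2 ≤ 1 / 4 ∧ (p.1.1 ≠ 1 → p.2 = 0)

/-- The correction term as a function on the group. -/
def corr (W : List ((Fin 3 × Bool) × ℚ)) (g : F3) : ℚ := corrL W g.toWord

theorem corr_step {W : List ((Fin 3 × Bool) × ℚ)} (hW : GoodW W) (g : F3) (i : Fin 3) :
    corr W (g * FreeGroup.of i) = corr W g ∨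
    (i = 1 ∧ corr W g ≤ corr W (g * FreeGroup.of i) ∧ corr W (g * FreeGroup.of i) ≤ corr W g + 1/4 ∧
      ∃ W1 d W2, W = W1 ++ ((1, true), d) :: W2 ∧ g = FreeGroup.mk (W1.map Prod.fst)) := by
  rcases toWord_step g i true with h | h
  · change (g * FreeGroup.of i).toWord = _ at h
    unfold corr
    rw [h]
    rcases corrL_step W g.toWord (i, true) with h1 | ⟨W1, d, W2, h1, h2, h3⟩
    · left; exact h1
    · have hd := hW ((i, true), d) (by simp [h1])
      simp only at hd
      by_cases hi : i = 1
      · right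
        refine ⟨hi, by linarith, by linarith, W1, d, W2, by rw [h1, hi], ?_⟩
        rw [← h2, FreeGroup.mk_toWord]
      · left; rw [h3, hd.2.2.2 hi, add_zero]
  · left
    change g.toWord = (g * FreeGroup.of i).toWord ++ _ at h
    unfold corr
    rcases corrL_step W (g * FreeGroup.of i).toWord (i, !true) with h1 | ⟨W1, d, W2, h1, h2, h3⟩
    · rw [h, h1]
    · have hd := hW ((i, !true), d) (by simp [h1])
      simp at hd

theorem corr_step_abs {W : List ((Fin 3 × Bool) × ℚ)} (hW : GoodW W) (g : F3) (i : Fin 3)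
    (b : Bool) : |corr W (g * FreeGroup.mk [(i, b)]) - corr W g| ≤ 1 / 4 := by
  cases b with
  | true =>
    change |corr W (g * FreeGroup.of i) - corr W g| ≤ 1 / 4
    rcases corr_step hW g i with h | ⟨_, h1, h2, _⟩
    · simp [h]
    · rw [abs_le]; constructor <;> linarith
  | false =>
    have e : FreeGroup.mk [(i, false)] = (FreeGroup.of i)⁻¹ := rfl
    rw [e]
    have := corr_step hW (g * (FreeGroup.of i)⁻¹) i
    simp only [inv_mul_cancel_right] at this
    rcases this with h | ⟨_, h1, h2, _⟩
    · simp [h]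
    · rw [abs_le]; constructor <;> linarith

theorem corr_lip {W : List ((Fin 3 × Bool) × ℚ)} (hW : GoodW W) (g h : F3) :
    |corr W (g * h) - corr W g| ≤ 1 / 4 * h.norm := by
  have key : ∀ (L : List (Fin 3 × Bool)) (g : F3),
      |corr W (g * FreeGroup.mk L) - corr W g| ≤ 1 / 4 * L.length := by
    intro L
    induction L with
    | nil => intro g; simp [← FreeGroup.one_eq_mk]
    | cons s L ih =>
      intro g
      have e : g * FreeGroup.mk (s :: L) = (g * FreeGroup.mk [s]) * FreeGroup.mk L := by
        rw [mul_assoc, FreeGroup.mul_mk]; rfl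
      rw [e]
      have h1 := ih (g * FreeGroup.mk [s])
      have h2 := corr_step_abs hW g s.1 s.2
      rw [abs_le] at *
      push_cast [List.length_cons]
      constructor <;> linarith [h1.1, h1.2, h2.1, h2.2]
  have := key h.toWord g
  rw [FreeGroup.mk_toWord] at this
  exact this

theorem corr_apow {W : List ((Fin 3 × Bool) × ℚ)} (hW : GoodW W) (g : F3) (t : ℕ) :
    corr W (g * ga ^ t) = corr W g := by
  induction t with
  | zero => simp
  | succ t ih =>
    rw [pow_succ, ← mul_assoc]
    rcases corr_step hW (g * ga ^ t) 0 with h | ⟨h, _⟩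
    · exact h.trans ih
    · simp at h

theorem corr_bpow {W : List ((Fin 3 × Bool) × ℚ)} (hW : GoodW W) (g : F3) (t : ℕ)
    (h : corr W (g * gb ^ t) ≠ corr W g) :
    ∃ t' : ℕ, ∃ W1 d W2, W = W1 ++ ((1, true), d) :: W2 ∧
      g * gb ^ t' = FreeGroup.mk (W1.map Prod.fst) := by
  induction t with
  | zero => simp at h
  | succ t ih =>
    by_cases h1 : corr W (g * gb ^ t) = corr W g
    · rw [pow_succ, ← mul_assoc] at h
      rcases corr_step hW (g * gb ^ t) 1 with h2 | ⟨_, _, _, W1, d, W2, h2, h3⟩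
      · exact absurd (h2.trans h1) h
      · exact ⟨t, W1, d, W2, h2, h3⟩
    · exact ih h1

/-- The weight of the `b`-edges in a block of level `n`. -/
def dn (n : ℕ) : ℚ := (5 ^ (2 * n - 1) + 1) / 5 ^ (2 * n)

/-- The weighted word of a block `a^(5^(2n)) b^(5^(2n)) c^k`. -/
def blk (p : ℕ × ℕ) : List ((Fin 3 × Bool) × ℚ) :=
  List.replicate (5 ^ (2 * p.1)) ((0, true), 0) ++
    (List.replicate (5 ^ (2 * p.1)) ((1, true), dn p.1) ++ List.replicate p.2 ((2, true), 0))

/-- The weighted word of a list of blocks. -/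
def WB (BL : List (ℕ × ℕ)) : List ((Fin 3 × Bool) × ℚ) := BL.flatMap blk

theorem pow_rel (n : ℕ) (hn : 2 ≤ n) : 5 ^ (2 * n) = 5 * 5 ^ (2 * n - 1) ∧
    5 * 5 ^ n ≤ 5 ^ (2 * n - 1) ∧ 125 ≤ 5 ^ (2 * n - 1) := by
  refine ⟨?_, ?_, ?_⟩
  · rw [← pow_succ']; congr 1; omega
  · rw [← pow_succ']; exact Nat.pow_le_pow_right (by norm_num) (by omega)
  · calc 125 = 5 ^ 3 := by norm_num
      _ ≤ _ := Nat.pow_le_pow_right (by norm_num) (by omega)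

theorem dn_mul (n : ℕ) : dn n * 5 ^ (2 * n) = 5 ^ (2 * n - 1) + 1 := by
  unfold dn; field_simp

theorem dn_nonneg (n : ℕ) : 0 ≤ dn n := by unfold dn; positivity

theorem dn_le (n : ℕ) (hn : 2 ≤ n) : dn n ≤ 1 / 4 := by
  obtain ⟨h1, -, h3⟩ := pow_rel n hn
  have h1' : (5 : ℚ) ^ (2 * n) = 5 * 5 ^ (2 * n - 1) := by exact_mod_cast h1
  have h3' : (125 : ℚ) ≤ 5 ^ (2 * n - 1) := by exact_mod_cast h3
  have := dn_mul n
  rw [h1'] at this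
  by_contra hc
  push Not at hc
  nlinarith

theorem goodW_WB (BL : List (ℕ × ℕ)) (h : ∀ p ∈ BL, 2 ≤ p.1) : GoodW (WB BL) := by
  intro q hq
  obtain ⟨p, hp, hq⟩ := List.mem_flatMap.1 hq
  simp only [blk, List.mem_append, List.mem_replicate] at hq
  rcases hq with ⟨_, rfl⟩ | ⟨_, rfl⟩ | ⟨_, rfl⟩
  · norm_num
  · exact ⟨rfl, dn_nonneg _, dn_le _ (h p hp), fun h => absurd rfl h⟩
  · norm_num

theorem rep_split {α : Type} (x y : α) (N : ℕ) (R W1 W2 : List α)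
    (h : List.replicate N x ++ R = W1 ++ y :: W2) :
    (y = x ∧ ∃ m, W1 = List.replicate m x) ∨
      ∃ W1', W1 = List.replicate N x ++ W1' ∧ R = W1' ++ y :: W2 := by
  induction N generalizing W1 with
  | zero => right; exact ⟨W1, by simp, by simpa using h⟩
  | succ N ih =>
    cases W1 with
    | nil =>
      left
      rw [List.replicate_succ] at h
      simp at h
      exact ⟨h.1.symm, 0, rfl⟩
    | cons z W1 =>
      rw [List.replicate_succ, List.cons_append, List.cons_append, List.cons.injEq] at h
      obtain ⟨rfl, h⟩ := h
      rcases ih W1 h with ⟨h1, m, h2⟩ | ⟨W1', h1, h2⟩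
      · left; exact ⟨h1, m + 1, by rw [h2, List.replicate_succ]⟩
      · right; exact ⟨W1', by rw [h1, List.replicate_succ, List.cons_append], h2⟩

theorem WB_split (BL : List (ℕ × ℕ)) (d : ℚ) (W1 W2 : List ((Fin 3 × Bool) × ℚ))
    (h : WB BL = W1 ++ ((1, true), d) :: W2) :
    ∃ B1 p B2 m, BL = B1 ++ p :: B2 ∧
      W1 = WB B1 ++ (List.replicate (5 ^ (2 * p.1)) ((0, true), 0) ++
        List.replicate m ((1, true), dn p.1)) := by
  induction BL generalizing W1 with
  | nil => simp [WB] at h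
  | cons p BL ih =>
    have e : WB (p :: BL) = blk p ++ WB BL := by simp [WB]
    rw [e, blk, List.append_assoc, List.append_assoc] at h
    rcases rep_split _ _ _ _ _ _ h with ⟨h1, _⟩ | ⟨W1', rfl, h2⟩
    · simp at h1
    rcases rep_split _ _ _ _ _ _ h2 with ⟨h1, m, rfl⟩ | ⟨W1'', rfl, h3⟩
    · exact ⟨[], p, BL, m, by simp, by simp [WB]⟩
    rcases rep_split _ _ _ _ _ _ h3 with ⟨h1, _⟩ | ⟨W1', rfl, h4⟩
    · simp at h1
    obtain ⟨B1, p', B2, m, h1, h2⟩ := ih W1' h4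
    exact ⟨p :: B1, p', B2, m, by simp [h1], by simp [h2, WB, blk]⟩

theorem red_append {L : List (Fin 3 × Bool)} (hL : FreeGroup.IsReduced L) (i : Fin 3) (e : Bool)
    (t : ℕ) (h : ∀ x ∈ L.getLast?, x.1 ≠ i) :
    FreeGroup.IsReduced (L ++ List.replicate t (i, e)) := by
  refine List.IsChain.append hL (List.isChain_replicate_of_rel t (fun _ => rfl)) ?_
  intro x hx y hy hxy
  have : y = (i, e) := List.eq_of_mem_replicate (List.mem_of_mem_head? hy)
  subst this
  exact absurd hxy (h x hx)

theorem red_pos (L : List (Fin 3 × Bool)) (h : ∀ x ∈ L, x.2 = true) : FreeGroup.IsReduced L := by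
  induction L with
  | nil => exact FreeGroup.IsReduced.nil
  | cons x L ih =>
    cases L with
    | nil => exact FreeGroup.IsReduced.singleton
    | cons y L =>
      rw [FreeGroup.IsReduced, List.isChain_cons_cons]
      refine ⟨fun _ => by rw [h x (by simp), h y (by simp)], ih fun z hz => h z (by simp [hz])⟩

theorem mk_rep (i : Fin 3) (t : ℕ) :
    FreeGroup.mk (List.replicate t (i, true)) = FreeGroup.of i ^ t := by
  induction t with
  | zero => rfl
  | succ t ih => rw [pow_succ', ← ih, List.replicate_succ, FreeGroup.of, FreeGroup.mul_mk]; rfl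

theorem mk_rep_neg (i : Fin 3) (t : ℕ) :
    FreeGroup.mk (List.replicate t (i, false)) = ((FreeGroup.of i)⁻¹) ^ t := by
  have e : (FreeGroup.of i)⁻¹ = FreeGroup.mk [(i, false)] := rfl
  induction t with
  | zero => rfl
  | succ t ih => rw [pow_succ', ← ih, List.replicate_succ, e, FreeGroup.mul_mk]; rfl

/-- The letters of a list of blocks. -/
def lett (BL : List (ℕ × ℕ)) : List (Fin 3 × Bool) := (WB BL).map Prod.fst

theorem lett_pos (BL : List (ℕ × ℕ)) : ∀ x ∈ lett BL, x.2 = true := by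
  intro x hx
  obtain ⟨q, hq, rfl⟩ := List.mem_map.1 hx
  obtain ⟨p, hp, hq⟩ := List.mem_flatMap.1 hq
  simp only [blk, List.mem_append, List.mem_replicate] at hq
  rcases hq with ⟨_, rfl⟩ | ⟨_, rfl⟩ | ⟨_, rfl⟩ <;> rfl

theorem lett_last (BL : List (ℕ × ℕ)) (h : ∀ p ∈ BL, 1 ≤ p.2) :
    ∀ x ∈ (lett BL).getLast?, x.1 ≠ 0 := by
  rcases List.eq_nil_or_concat BL with rfl | ⟨B, p, rfl⟩
  · simp [lett, WB]
  · have := h p (by simp)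
    have hne : p.2 ≠ 0 := by omega
    intro x hx
    simp [lett, WB, blk, List.getLast?_append, List.getLast?_replicate, hne] at hx
    simp [← hx]

theorem WB_append (B1 B2 : List (ℕ × ℕ)) : WB (B1 ++ B2) = WB B1 ++ WB B2 := by simp [WB]
theorem WB_cons (p : ℕ × ℕ) (B2 : List (ℕ × ℕ)) : WB (p :: B2) = blk p ++ WB B2 := by simp [WB]

theorem word_nat (B1 : List (ℕ × ℕ)) (N t : ℕ) :
    (FreeGroup.mk (lett B1) * ga ^ N * gb ^ t : F3).toWord =
      lett B1 ++ List.replicate N (0, true) ++ List.replicate t (1, true) := by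
  rw [ga, gb, ← mk_rep, ← mk_rep, FreeGroup.mul_mk, FreeGroup.mul_mk, FreeGroup.toWord_mk,
    FreeGroup.IsReduced.reduce_eq]
  apply red_pos
  intro x hx
  simp only [List.mem_append, List.mem_replicate] at hx
  rcases hx with (hx | ⟨_, rfl⟩) | ⟨_, rfl⟩
  · exact lett_pos _ _ hx
  · rfl
  · rfl

theorem word_neg (B1 : List (ℕ × ℕ)) (N t : ℕ) (hN : N ≠ 0) :
    (FreeGroup.mk (lett B1) * ga ^ N * gb⁻¹ ^ t : F3).toWord =
      lett B1 ++ List.replicate N (0, true) ++ List.replicate t (1, false) := by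
  rw [ga, gb, ← mk_rep, ← mk_rep_neg, FreeGroup.mul_mk, FreeGroup.mul_mk, FreeGroup.toWord_mk,
    FreeGroup.IsReduced.reduce_eq]
  apply red_append
  · apply red_pos
    intro x hx
    simp only [List.mem_append, List.mem_replicate] at hx
    rcases hx with hx | ⟨_, rfl⟩
    · exact lett_pos _ _ hx
    · rfl
  · intro x hx
    simp [List.getLast?_append, List.getLast?_replicate, hN] at hx
    simp [← hx]

/-- The weight of the part before the current `b`-segment plus the clamped height. -/
theorem corr_formula (B1 B2 : List (ℕ × ℕ)) (p : ℕ × ℕ) (hp : 1 ≤ p.2) :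
    ∃ S : ℚ, ∀ s : ℤ,
      corr (WB (B1 ++ p :: B2)) (FreeGroup.mk (lett B1) * ga ^ (5 ^ (2 * p.1)) * gb ^ s) =
        S + dn p.1 * (min (5 ^ (2 * p.1)) s.toNat : ℕ) := by
  set N := 5 ^ (2 * p.1) with hN
  have hN0 : N ≠ 0 := by positivity
  set W1 : List ((Fin 3 × Bool) × ℚ) := WB B1 ++ List.replicate N ((0, true), 0) with hW1
  set W3 : List ((Fin 3 × Bool) × ℚ) := List.replicate p.2 ((2, true), 0) ++ WB B2 with hW3
  have hW : WB (B1 ++ p :: B2) = W1 ++ (List.replicate N ((1, true), dn p.1) ++ W3) := by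
    rw [WB_append, WB_cons, blk, hW1, hW3]; simp [hN]
  have hmap : W1.map Prod.fst = lett B1 ++ List.replicate N (0, true) := by simp [hW1, lett]
  have hhead : ∀ q ∈ W3.head?, q.1 ≠ (1, true) := by
    have : p.2 ≠ 0 := by omega
    intro q hq
    simp [hW3, List.head?_append, List.head?_replicate, this] at hq
    simp [← hq]
  refine ⟨(W1.map Prod.snd).sum, fun s => ?_⟩
  unfold corr
  rcases le_or_gt 0 s with hs | hs
  · lift s to ℕ using hs
    rw [zpow_natCast, word_nat, hW, ← hmap, corrL_append_eq, corrL_replicate _ _ _ _ _ hhead]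
    simp
  · obtain ⟨t, rfl⟩ : ∃ t : ℕ, s = -((t + 1 : ℕ) : ℤ) := ⟨(-s - 1).toNat, by omega⟩
    have e : gb ^ (-((t + 1 : ℕ) : ℤ)) = gb⁻¹ ^ (t + 1) := by
      rw [zpow_neg, zpow_natCast, inv_pow]
    rw [e, word_neg _ _ _ hN0, hW, ← hmap, corrL_append_eq]
    have : (-((t + 1 : ℕ) : ℤ)).toNat = 0 := by omega
    rw [this]
    obtain ⟨N', hN'⟩ := Nat.exists_eq_succ_of_ne_zero hN0
    rw [hN', List.replicate_succ, List.replicate_succ]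
    simp [corrL]

theorem clamp_aux (N Nj : ℕ) (s : ℤ) : min N (s + (Nj : ℤ)).toNat ≤ min N s.toNat + N ∧
    min N (s + (Nj : ℤ)).toNat ≤ min N s.toNat + Nj := by omega

theorem caseA1 (B1 B2 : List (ℕ × ℕ)) (p : ℕ × ℕ) (hp : 1 ≤ p.2) (hp2 : 2 ≤ p.1) (s : ℤ) (j : ℕ)
    (hj : 2 ≤ j) :
    corr (WB (B1 ++ p :: B2))
      (FreeGroup.mk (lett B1) * ga ^ (5 ^ (2 * p.1)) * gb ^ s * gb ^ (5 ^ (2 * j))) ≤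
    corr (WB (B1 ++ p :: B2)) (FreeGroup.mk (lett B1) * ga ^ (5 ^ (2 * p.1)) * gb ^ s)
      + (5 ^ (2 * j - 1) + 1) := by
  obtain ⟨S, hS⟩ := corr_formula B1 B2 p hp
  have e : FreeGroup.mk (lett B1) * ga ^ (5 ^ (2 * p.1)) * gb ^ s * gb ^ (5 ^ (2 * j)) =
      FreeGroup.mk (lett B1) * ga ^ (5 ^ (2 * p.1)) * gb ^ (s + ((5 ^ (2 * j) : ℕ) : ℤ)) := by
    rw [zpow_add, zpow_natCast, mul_assoc _ (gb ^ s)]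
  rw [e, hS, hS]
  set N := 5 ^ (2 * p.1) with hN
  set Nj := 5 ^ (2 * j) with hNj
  have h0 := dn_nonneg p.1
  have hd := dn_mul p.1
  rcases le_total p.1 j with hle | hle
  · have h1 : min N (s + (Nj : ℤ)).toNat ≤ min N s.toNat + N := (clamp_aux N Nj s).1
    have h1' : ((min N (s + (Nj : ℤ)).toNat : ℕ) : ℚ) ≤ (min N s.toNat : ℕ) + N := by
      exact_mod_cast h1
    have h2 : (5 : ℚ) ^ (2 * p.1 - 1) ≤ 5 ^ (2 * j - 1) :=
      pow_le_pow_right₀ (by norm_num) (by omega)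
    have h3 : (N : ℚ) = 5 ^ (2 * p.1) := by simp [hN]
    have h4 := mul_le_mul_of_nonneg_left h1' h0
    rw [mul_add, h3, hd] at h4
    linarith
  · have h1 : min N (s + (Nj : ℤ)).toNat ≤ min N s.toNat + Nj := (clamp_aux N Nj s).2
    have h1' : ((min N (s + (Nj : ℤ)).toNat : ℕ) : ℚ) ≤ (min N s.toNat : ℕ) + Nj := by
      exact_mod_cast h1
    have h4 := mul_le_mul_of_nonneg_left h1' h0
    have h3 : (Nj : ℚ) = 5 ^ (2 * j) := by simp [hNj]
    have h5 : dn p.1 * Nj ≤ 5 ^ (2 * j - 1) + 1 := by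
      rw [h3]
      have r1 : (5 : ℚ) ^ (2 * j) = 5 * 5 ^ (2 * j - 1) := by exact_mod_cast (pow_rel j hj).1
      have r2 : (5 : ℚ) ^ (2 * p.1) = 5 * 5 ^ (2 * p.1 - 1) := by
        exact_mod_cast (pow_rel p.1 hp2).1
      have r3 : (5 : ℚ) ^ (2 * j) ≤ 5 ^ (2 * p.1) := pow_le_pow_right₀ (by norm_num) (by omega)
      have r4 : dn p.1 = 1 / 5 + 1 / 5 ^ (2 * p.1) := by
        unfold dn
        rw [r2]; field_simp
      rw [r4, add_mul]
      have r5 : 1 / (5 : ℚ) ^ (2 * p.1) * 5 ^ (2 * j) ≤ 1 := by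
        rw [one_div, inv_mul_le_iff₀ (by positivity)]; linarith
      linarith
    rw [mul_add] at h4
    linarith

theorem corr_keep {W : List ((Fin 3 × Bool) × ℚ)} (hW : ∀ p ∈ W, p.1.2 = true) (g h : F3)
    (A : List (Fin 3 × Bool)) (i : Fin 3) (t : ℕ)
    (hg : g.toWord = A ++ List.replicate t (i, false)) (ht : h.norm < t) :
    corr W (g * h) = corr W g := by
  obtain ⟨t, rfl⟩ := Nat.exists_eq_succ_of_ne_zero (show t ≠ 0 by omega)
  rw [List.replicate_succ] at hg
  have hg' : g.toWord = (A ++ [(i, false)]) ++ List.replicate t (i, false) := by simp [hg]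
  obtain ⟨Z', hZ, -⟩ := toWord_keep h g _ _ hg' (by simp; omega)
  unfold corr
  rw [hZ, hg, List.append_assoc, List.singleton_append]
  exact corrL_off W hW _ _ _ _

theorem caseA2 (B1 B2 : List (ℕ × ℕ)) (p : ℕ × ℕ)
    (hB : ∀ q ∈ B1 ++ p :: B2, 2 ≤ q.1 ∧ 1 ≤ q.2)
    (hch : (B1 ++ p :: B2).IsChain (fun q q' => 3 * 5 ^ (2 * q'.1) < q.2))
    (s : ℤ) (j : ℕ) (h : F3) (hh : 3 * h.norm ≤ 5 ^ (2 * j)) :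
    corr (WB (B1 ++ p :: B2))
      (FreeGroup.mk (lett B1) * ga ^ (5 ^ (2 * p.1)) * gb ^ s * ga⁻¹ ^ (5 ^ (2 * j)) * h) =
    corr (WB (B1 ++ p :: B2))
      (FreeGroup.mk (lett B1) * ga ^ (5 ^ (2 * p.1)) * gb ^ s * ga⁻¹ ^ (5 ^ (2 * j))) := by
  have hW : ∀ q ∈ WB (B1 ++ p :: B2), q.1.2 = true :=
    fun q hq => (goodW_WB _ (fun q hq => (hB q hq).1) q hq).1
  have hpos : 0 < 5 ^ (2 * j) := by positivity
  have hN0 : 5 ^ (2 * p.1) ≠ 0 := by positivity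
  have hlast := lett_last B1 (fun q hq => (hB q (by simp [hq])).2)
  have hga : ∀ t, ga⁻¹ ^ t = FreeGroup.mk (List.replicate t (0, false)) := fun t => by
    rw [ga, mk_rep_neg]
  rcases lt_trichotomy s 0 with hs | rfl | hs
  · obtain ⟨t, rfl⟩ : ∃ t : ℕ, s = -((t + 1 : ℕ) : ℤ) := ⟨(-s - 1).toNat, by omega⟩
    have e : gb ^ (-((t + 1 : ℕ) : ℤ)) = gb⁻¹ ^ (t + 1) := by
      rw [zpow_neg, zpow_natCast, inv_pow]
    rw [e]
    refine corr_keep hW _ _ (FreeGroup.mk (lett B1) * ga ^ (5 ^ (2 * p.1)) * gb⁻¹ ^ (t + 1)).toWord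
      0 (5 ^ (2 * j)) ?_ (by omega)
    conv_lhs => rw [← FreeGroup.mk_toWord (x := FreeGroup.mk (lett B1) * _ * _), hga,
      FreeGroup.mul_mk, FreeGroup.toWord_mk]
    apply FreeGroup.IsReduced.reduce_eq
    apply red_append FreeGroup.isReduced_toWord
    rw [word_neg _ _ _ hN0]
    intro x hx
    simp [List.getLast?_append, List.getLast?_replicate] at hx
    simp [← hx]
  · have e0 : ∀ g : F3, g * gb ^ (0 : ℤ) = g := by simp
    rw [e0]
    rcases lt_or_ge p.1 j with hpj | hpj
    · have hlt : 25 * 5 ^ (2 * p.1) ≤ 5 ^ (2 * j) := by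
        calc 25 * 5 ^ (2 * p.1) = 5 ^ (2 * p.1 + 2) := by ring
          _ ≤ _ := Nat.pow_le_pow_right (by norm_num) (by omega)
      have e : FreeGroup.mk (lett B1) * ga ^ (5 ^ (2 * p.1)) * ga⁻¹ ^ (5 ^ (2 * j)) =
          FreeGroup.mk (lett B1) * ga⁻¹ ^ (5 ^ (2 * j) - 5 ^ (2 * p.1)) := by
        obtain ⟨t, ht⟩ := Nat.exists_eq_add_of_le (show 5 ^ (2 * p.1) ≤ 5 ^ (2 * j) by omega)
        rw [ht, Nat.add_sub_cancel_left, pow_add, inv_pow, mul_assoc, mul_inv_cancel_left]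
      rw [e]
      refine corr_keep hW _ _ (lett B1) 0 (5 ^ (2 * j) - 5 ^ (2 * p.1)) ?_ (by omega)
      rw [hga, FreeGroup.mul_mk, FreeGroup.toWord_mk]
      apply FreeGroup.IsReduced.reduce_eq
      exact red_append (red_pos _ (lett_pos _)) _ _ _ hlast
    · have hle : 5 ^ (2 * j) ≤ 5 ^ (2 * p.1) := Nat.pow_le_pow_right (by norm_num) (by omega)
      obtain ⟨t, ht⟩ := Nat.exists_eq_add_of_le hle
      have e : FreeGroup.mk (lett B1) * ga ^ (5 ^ (2 * p.1)) * ga⁻¹ ^ (5 ^ (2 * j)) =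
          FreeGroup.mk (lett B1) * ga ^ t := by
        rw [ht, add_comm, pow_add, inv_pow]; group
      rw [e]
      have hw : (FreeGroup.mk (lett B1) * ga ^ t : F3).toWord =
          lett B1 ++ List.replicate t (0, true) := by
        have := word_nat B1 t 0
        simpa using this
      rcases List.eq_nil_or_concat B1 with rfl | ⟨B, q, rfl⟩
      · unfold corr
        have hWe : WB ([] ++ p :: B2) = List.replicate (5 ^ (2 * p.1)) ((0, true), 0) ++
            (List.replicate (5 ^ (2 * p.1)) ((1, true), dn p.1) ++
              List.replicate p.2 ((2, true), 0) ++ WB B2) := by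
          rw [List.nil_append, WB_cons, blk]; simp
        have hz : ∀ x ∈ List.replicate (5 ^ (2 * p.1)) (((0, true), 0) : (Fin 3 × Bool) × ℚ),
            x.2 = 0 := by
          intro x hx; rw [List.eq_of_mem_replicate hx]
        have hl : (FreeGroup.mk (lett []) * ga ^ t : F3).norm = t := by
          rw [FreeGroup.norm, hw]; simp [lett, WB]
        rw [hWe, corrL_zero _ _ hz, corrL_zero _ _ hz]
        · rw [← FreeGroup.norm, hl, List.length_replicate]; omega
        · have := FreeGroup.norm_mul_le (FreeGroup.mk (lett []) * ga ^ t) h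
          rw [← FreeGroup.norm, List.length_replicate]; omega
      · rw [List.concat_eq_append] at *
        have hsep : 3 * 5 ^ (2 * p.1) < q.2 := by
          rw [List.append_assoc, List.singleton_append] at hch
          exact (List.isChain_append_cons_cons.1 hch).2.1
        set W1 : List ((Fin 3 × Bool) × ℚ) := WB B ++
          (List.replicate (5 ^ (2 * q.1)) ((0, true), 0) ++
            List.replicate (5 ^ (2 * q.1)) ((1, true), dn q.1)) with hW1
        set W0 : List ((Fin 3 × Bool) × ℚ) := List.replicate q.2 ((2, true), 0) ++
          List.replicate (5 ^ (2 * p.1)) ((0, true), 0) with hW0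
        have hWe : WB (B ++ [q] ++ p :: B2) = W1 ++ (W0 ++
            (List.replicate (5 ^ (2 * p.1)) ((1, true), dn p.1) ++
              List.replicate p.2 ((2, true), 0) ++ WB B2)) := by
          rw [List.append_assoc, WB_append, List.singleton_append, WB_cons, WB_cons, blk, blk,
            hW1, hW0]
          simp
        have hz : ∀ x ∈ W0, x.2 = 0 := by
          intro x hx
          simp only [hW0, List.mem_append, List.mem_replicate] at hx
          rcases hx with ⟨_, rfl⟩ | ⟨_, rfl⟩ <;> rfl
        have hlw : lett (B ++ [q]) ++ List.replicate t (0, true) = W1.map Prod.fst ++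
            (List.replicate q.2 (2, true) ++ List.replicate t (0, true)) := by
          simp [lett, blk, hW1, WB]
        rw [hlw] at hw
        have hlen0 : W0.length = q.2 + 5 ^ (2 * p.1) := by simp [hW0]
        obtain ⟨Z', h1, h2⟩ := toWord_keep h _ _ _ hw (by simp; omega)
        simp only [List.length_append, List.length_replicate] at h2
        unfold corr
        rw [h1, hw, hWe, corrL_append_eq, corrL_append_eq, corrL_zero _ _ hz, corrL_zero _ _ hz]
        · rw [hlen0]; simp; omega
        · rw [hlen0]; omega
  · obtain ⟨t, rfl⟩ : ∃ t : ℕ, s = ((t + 1 : ℕ) : ℤ) := ⟨(s - 1).toNat, by omega⟩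
    rw [zpow_natCast]
    refine corr_keep hW _ _ (FreeGroup.mk (lett B1) * ga ^ (5 ^ (2 * p.1)) * gb ^ (t + 1)).toWord
      0 (5 ^ (2 * j)) ?_ (by omega)
    conv_lhs => rw [← FreeGroup.mk_toWord (x := FreeGroup.mk (lett B1) * _ * _), hga,
      FreeGroup.mul_mk, FreeGroup.toWord_mk]
    apply FreeGroup.IsReduced.reduce_eq
    apply red_append FreeGroup.isReduced_toWord
    rw [word_nat]
    intro x hx
    simp [List.getLast?_append, List.getLast?_replicate] at hx
    simp [← hx]

/-- The homomorphism `a ↦ 1, b ↦ -1, c ↦ 1`. -/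
def phi : F3 →* Multiplicative ℚ :=
  FreeGroup.lift (fun i => Multiplicative.ofAdd (if i = 1 then (-1 : ℚ) else 1))

/-- The additive version of `phi`. -/
def ph (g : F3) : ℚ := Multiplicative.toAdd (phi g)

theorem ph_mul (g h : F3) : ph (g * h) = ph g + ph h := by simp [ph]
theorem ph_one : ph 1 = 0 := by simp [ph]
theorem ph_inv (g : F3) : ph g⁻¹ = - ph g := by simp [ph]
theorem ph_pow (g : F3) (t : ℕ) : ph (g ^ t) = t * ph g := by simp [ph]
theorem ph_a : ph ga = 1 := by simp [ph, phi, ga]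
theorem ph_b : ph gb = -1 := by simp [ph, phi, gb]
theorem ph_c : ph gc = 1 := by simp [ph, phi, gc]

theorem x_step (BL : List (ℕ × ℕ)) (hB : ∀ q ∈ BL, 2 ≤ q.1 ∧ 1 ≤ q.2)
    (hch : BL.IsChain (fun q q' => 3 * 5 ^ (2 * q'.1) < q.2)) (g v : F3) (j : ℕ) (hj : 2 ≤ j)
    (hv : v.norm ≤ 5 ^ j) :
    corr (WB BL) (g * xgen v j) ≤ corr (WB BL) g + (5 ^ (2 * j - 1) + 1) := by
  have hW := goodW_WB BL (fun q hq => (hB q hq).1)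
  obtain ⟨r1, r2, r3⟩ := pow_rel j hj
  set h : F3 := v * gb ^ (5 ^ (2 * j - 1)) * v⁻¹ with hh
  have hn : h.norm ≤ 2 * 5 ^ j + 5 ^ (2 * j - 1) := by
    have h1 := FreeGroup.norm_mul_le (v * gb ^ (5 ^ (2 * j - 1))) v⁻¹
    have h2 := FreeGroup.norm_mul_le v (gb ^ (5 ^ (2 * j - 1)))
    rw [gb, FreeGroup.norm_of_pow] at h2
    rw [FreeGroup.norm_inv_eq] at h1
    rw [hh]
    change (v * gb ^ (5 ^ (2 * j - 1)) * v⁻¹).norm ≤ _ at h1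
    change (v * gb ^ (5 ^ (2 * j - 1))).norm ≤ _ at h2
    omega
  have hy : corr (WB BL) (g * h * ga ^ (5 ^ (2 * j))) = corr (WB BL) (g * h) := corr_apow hW _ _
  have hx : g * xgen v j = g * h * ga ^ (5 ^ (2 * j)) * gb ^ (5 ^ (2 * j)) := by
    simp only [xgen, hh, mul_assoc]
  rw [hx]
  by_cases hc : corr (WB BL) (g * h * ga ^ (5 ^ (2 * j)) * gb ^ (5 ^ (2 * j))) =
      corr (WB BL) (g * h * ga ^ (5 ^ (2 * j)))
  · rw [hc, hy]
    have h1 := (abs_le.1 (corr_lip hW g h)).2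
    have h2 : (h.norm : ℚ) ≤ 2 * 5 ^ (2 * j - 1) := by
      have : h.norm ≤ 2 * 5 ^ (2 * j - 1) := by omega
      exact_mod_cast this
    have h3 : (0 : ℚ) < 5 ^ (2 * j - 1) := by positivity
    linarith
  · obtain ⟨t, W1, d, W2, h1, h2⟩ := corr_bpow hW _ _ hc
    obtain ⟨B1, p, B2, m, rfl, h3⟩ := WB_split BL d W1 W2 h1
    have hp := hB p (by simp)
    have e1 : g * h * ga ^ (5 ^ (2 * j)) =
        FreeGroup.mk (lett B1) * ga ^ (5 ^ (2 * p.1)) * gb ^ ((m : ℤ) - (t : ℤ)) := by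
      have : g * h * ga ^ (5 ^ (2 * j)) * gb ^ t =
          FreeGroup.mk (lett B1) * ga ^ (5 ^ (2 * p.1)) * gb ^ m := by
        rw [h2, h3, List.map_append, List.map_append, List.map_replicate, List.map_replicate,
          ← FreeGroup.mul_mk, ← FreeGroup.mul_mk, mk_rep, mk_rep, lett, ga, gb, mul_assoc]
      rw [zpow_sub, zpow_natCast, zpow_natCast, ← mul_assoc (FreeGroup.mk (lett B1) * _)]
      exact eq_mul_inv_of_mul_eq this
    have e2 : g = FreeGroup.mk (lett B1) * ga ^ (5 ^ (2 * p.1)) * gb ^ ((m : ℤ) - (t : ℤ)) *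
        ga⁻¹ ^ (5 ^ (2 * j)) * h⁻¹ := by
      rw [← e1, inv_pow]; group
    have e3 : g * h = FreeGroup.mk (lett B1) * ga ^ (5 ^ (2 * p.1)) * gb ^ ((m : ℤ) - (t : ℤ)) *
        ga⁻¹ ^ (5 ^ (2 * j)) := by
      rw [← e1, inv_pow]; group
    have h4 := caseA2 B1 B2 p hB hch ((m : ℤ) - (t : ℤ)) j h⁻¹
      (by rw [FreeGroup.norm_inv_eq]; omega)
    rw [← e2, ← e3] at h4
    have h5 := caseA1 B1 B2 p hp.2 hp.1 ((m : ℤ) - (t : ℤ)) j hj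
    rw [← e1, hy] at h5
    rw [h4]
    exact h5

/-- The calibration. -/
def Fcal (BL : List (ℕ × ℕ)) (g : F3) : ℚ := ph g + corr (WB BL) g

theorem F_step (BL : List (ℕ × ℕ)) (hB : ∀ q ∈ BL, 2 ≤ q.1 ∧ 1 ≤ q.2)
    (hch : BL.IsChain (fun q q' => 3 * 5 ^ (2 * q'.1) < q.2)) (g x : F3) (hx : x ∈ Xgen) :
    Fcal BL (g * x) ≤ Fcal BL g + 1 := by
  have hW := goodW_WB BL (fun q hq => (hB q hq).1)
  have hinv : ∀ i : Fin 3, corr (WB BL) (g * (FreeGroup.of i)⁻¹) ≤ corr (WB BL) g ∧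
      (i ≠ 1 → corr (WB BL) (g * (FreeGroup.of i)⁻¹) = corr (WB BL) g) := by
    intro i
    have := corr_step hW (g * (FreeGroup.of i)⁻¹) i
    rw [inv_mul_cancel_right] at this
    rcases this with h | ⟨h0, h1, _⟩
    · exact ⟨h.symm.le, fun _ => h.symm⟩
    · exact ⟨h1, fun h => absurd h0 h⟩
  unfold Fcal
  rw [ph_mul]
  rcases hx with hx | hx
  · simp only [Xinf, Set.mem_iUnion, Set.mem_ofPred_eq] at hx
    obtain ⟨j, hj, v, hv, rfl⟩ := hx
    have h1 := x_step BL hB hch g v j hj hv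
    have h2 : ph (xgen v j) = - 5 ^ (2 * j - 1) := by
      simp only [xgen, ph_mul, ph_inv, ph_pow, ph_a, ph_b]
      push_cast; ring
    linarith
  · simp only [Sgen, Set.mem_insert_iff, Set.mem_singleton_iff] at hx
    rcases hx with rfl | rfl | rfl | rfl | rfl | rfl
    · rcases corr_step hW g 0 with h | ⟨h, _⟩
      · rw [← ga] at h
        rw [h, ph_a]; linarith
      · simp at h
    · have h : corr (WB BL) (g * gb) ≤ corr (WB BL) g + 1 / 4 := by
        rcases corr_step hW g 1 with h | ⟨_, _, h, _⟩
        · rw [← gb] at h; linarith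
        · exact h
      rw [ph_b]; linarith
    · rcases corr_step hW g 2 with h | ⟨h, _⟩
      · rw [← gc] at h
        rw [h, ph_c]; linarith
      · simp at h
    · have := (hinv 0).1
      rw [← ga] at this
      rw [ph_inv, ph_a]; linarith
    · have := (hinv 1).1
      rw [← gb] at this
      rw [ph_inv, ph_b]; linarith
    · have := (hinv 2).1
      rw [← gc] at this
      rw [ph_inv, ph_c]; linarith

theorem F_list (BL : List (ℕ × ℕ)) (hB : ∀ q ∈ BL, 2 ≤ q.1 ∧ 1 ≤ q.2)
    (hch : BL.IsChain (fun q q' => 3 * 5 ^ (2 * q'.1) < q.2)) (l : List F3)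
    (hl : ∀ x ∈ l, x ∈ Xgen) : Fcal BL l.prod ≤ l.length := by
  induction l using List.reverseRecOn with
  | nil => simp [Fcal, ph_one, corr]
  | append_singleton l x ih =>
    have h1 := ih (fun y hy => hl y (by simp [hy]))
    have h2 := F_step BL hB hch l.prod x (hl x (by simp))
    simp only [List.prod_append, List.prod_singleton, List.length_append, List.length_singleton]
    push_cast
    linarith

theorem mk_lett (BL : List (ℕ × ℕ)) : (FreeGroup.mk (lett BL) : F3) =
    (BL.map (fun p => ga ^ (5 ^ (2 * p.1)) * gb ^ (5 ^ (2 * p.1)) * gc ^ p.2)).prod := by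
  induction BL with
  | nil => rfl
  | cons p BL ih =>
    rw [List.map_cons, List.prod_cons, ← ih, lett, WB_cons, blk]
    simp only [List.map_append, List.map_replicate, ← FreeGroup.mul_mk, mk_rep, lett, ga, gb, gc,
      mul_assoc]

theorem sum_WB (BL : List (ℕ × ℕ)) :
    ((WB BL).map Prod.snd).sum = (BL.map (fun p => (5 ^ (2 * p.1 - 1) + 1 : ℚ))).sum := by
  induction BL with
  | nil => rfl
  | cons p BL ih =>
    rw [List.map_cons, List.sum_cons, ← ih, WB_cons, blk, ← dn_mul]
    simp
    ring

theorem ph_w (BL : List (ℕ × ℕ)) :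
    ph (BL.map (fun p => ga ^ (5 ^ (2 * p.1)) * gb ^ (5 ^ (2 * p.1)) * gc ^ p.2)).prod =
      (BL.map (fun p => (p.2 : ℚ))).sum := by
  induction BL with
  | nil => exact ph_one
  | cons p BL ih =>
    rw [List.map_cons, List.prod_cons, List.map_cons, List.sum_cons, ← ih]
    simp only [ph_mul, ph_pow, ph_a, ph_b, ph_c]
    ring

theorem F_w (BL : List (ℕ × ℕ)) :
    Fcal BL (BL.map (fun p => ga ^ (5 ^ (2 * p.1)) * gb ^ (5 ^ (2 * p.1)) * gc ^ p.2)).prod =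
      (BL.map (fun p => (p.2 : ℚ))).sum + (BL.map (fun p => (5 ^ (2 * p.1 - 1) + 1 : ℚ))).sum := by
  unfold Fcal
  rw [ph_w, ← sum_WB, ← mk_lett]
  congr 1
  unfold corr
  rw [FreeGroup.toWord_mk, FreeGroup.IsReduced.reduce_eq (red_pos _ (lett_pos _))]
  have := corrL_append_eq (WB BL) [] []
  simpa [lett] using this

/-- `g` is a product of `m` elements of `X`. -/
def XRep (g : F3) (m : ℕ) : Prop := ∃ l : List F3, (∀ x ∈ l, x ∈ Xgen) ∧ l.prod = g ∧ l.length = m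

theorem XRep.le {g : F3} {m : ℕ} (h : XRep g m) : wordLen Xgen g ≤ m := Nat.sInf_le h

theorem XRep.att {g : F3} {m : ℕ} (h : XRep g m) : XRep g (wordLen Xgen g) :=
  Nat.sInf_mem (s := {n : ℕ | XRep g n}) ⟨m, h⟩

theorem XRep.mul {g h : F3} {m n : ℕ} (h1 : XRep g m) (h2 : XRep h n) : XRep (g * h) (m + n) := by
  obtain ⟨l, a1, rfl, rfl⟩ := h1
  obtain ⟨l', b1, rfl, rfl⟩ := h2
  refine ⟨l ++ l', ?_, by simp, by simp⟩
  intro x hx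
  rcases List.mem_append.1 hx with hx | hx
  · exact a1 x hx
  · exact b1 x hx

theorem XRep.single {g : F3} (h : g ∈ Xgen) : XRep g 1 := ⟨[g], by simpa using h, by simp, rfl⟩

theorem XRep.pow {g : F3} (h : g ∈ Xgen) (t : ℕ) : XRep (g ^ t) t := by
  refine ⟨List.replicate t g, ?_, by simp, by simp⟩
  intro x hx
  rw [List.eq_of_mem_replicate hx]; exact h

theorem rep_ab (n : ℕ) (hn : 2 ≤ n) :
    XRep (ga ^ (5 ^ (2 * n)) * gb ^ (5 ^ (2 * n))) (5 ^ (2 * n - 1) + 1) := by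
  have h1 : XRep (gb⁻¹ ^ (5 ^ (2 * n - 1))) (5 ^ (2 * n - 1)) :=
    XRep.pow (Or.inr (by simp [Sgen])) _
  have h2 : XRep (xgen 1 n) 1 := by
    apply XRep.single
    left
    simp only [Xinf, Set.mem_iUnion, Set.mem_ofPred_eq]
    exact ⟨n, hn, 1, by simp, rfl⟩
  have h3 := h1.mul h2
  have e : gb⁻¹ ^ (5 ^ (2 * n - 1)) * xgen 1 n = ga ^ (5 ^ (2 * n)) * gb ^ (5 ^ (2 * n)) := by
    simp only [xgen, inv_pow, one_mul, inv_one, mul_one, mul_assoc, inv_mul_cancel_left]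
  rwa [e] at h3

theorem rep_c (k : ℕ) : XRep (gc ^ k) k := XRep.pow (Or.inr (by simp [Sgen])) _

/-- Equation (3) of the paper: additivity of the `X`-word length over the factorization
`a^(5^(2n₁)) b^(5^(2n₁)) c^(k₁) ⋯ a^(5^(2n_r)) b^(5^(2n_r)) c^(k_r)`
when `n₁, …, n_r ≥ 2`, `k₁, …, k_r ≥ 1` and `k_{i-1} > 3·5^(2 n_i)` for `i = 2, …, r`.
(Indices are shifted: `i = 0, …, r-1` here corresponds to `i = 1, …, r` in the paper.) -/
theorem wordLen_prod_additive (r : ℕ) (hr : 1 ≤ r) (n k : ℕ → ℕ)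
    (hn : ∀ i < r, 2 ≤ n i) (hk : ∀ i < r, 1 ≤ k i)
    (hsep : ∀ i, 1 ≤ i → i < r → 3 * 5 ^ (2 * n i) < k (i - 1)) :
    wordLen Xgen
        (((List.range r).map
          (fun i => ga ^ (5 ^ (2 * n i)) * gb ^ (5 ^ (2 * n i)) * gc ^ (k i))).prod)
      = (∑ i ∈ Finset.range r, wordLen Xgen (ga ^ (5 ^ (2 * n i)) * gb ^ (5 ^ (2 * n i))))
        + ∑ i ∈ Finset.range r, wordLen Xgen (gc ^ (k i)) := by
  set w := ((List.range r).map
    (fun i => ga ^ (5 ^ (2 * n i)) * gb ^ (5 ^ (2 * n i)) * gc ^ (k i))).prod with hw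
  have hup : ∀ s ≤ r, XRep ((List.range s).map
      (fun i => ga ^ (5 ^ (2 * n i)) * gb ^ (5 ^ (2 * n i)) * gc ^ (k i))).prod
      ((∑ i ∈ Finset.range s, wordLen Xgen (ga ^ (5 ^ (2 * n i)) * gb ^ (5 ^ (2 * n i))))
        + ∑ i ∈ Finset.range s, wordLen Xgen (gc ^ (k i))) := by
    intro s
    induction s with
    | zero => intro _; exact ⟨[], by simp, by simp, by simp⟩
    | succ s ih =>
      intro hs
      have h1 := (ih (by omega)).mul ((rep_ab (n s) (hn s (by omega))).att.mul (rep_c (k s)).att)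
      rw [List.range_succ, List.map_append, List.prod_append, Finset.sum_range_succ,
        Finset.sum_range_succ, List.map_singleton, List.prod_singleton]
      convert h1 using 1
      ring
  have hRep := hup r le_rfl
  apply le_antisymm hRep.le
  have hle1 : ∑ i ∈ Finset.range r, wordLen Xgen (ga ^ (5 ^ (2 * n i)) * gb ^ (5 ^ (2 * n i))) ≤
      ∑ i ∈ Finset.range r, (5 ^ (2 * n i - 1) + 1) :=
    Finset.sum_le_sum fun i hi => (rep_ab (n i) (hn i (Finset.mem_range.1 hi))).le
  have hle2 : ∑ i ∈ Finset.range r, wordLen Xgen (gc ^ (k i)) ≤ ∑ i ∈ Finset.range r, k i :=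
    Finset.sum_le_sum fun i hi => (rep_c (k i)).le
  refine (Nat.add_le_add hle1 hle2).trans ?_
  set BL : List (ℕ × ℕ) := (List.range r).map (fun i => (n i, k i)) with hBL
  have hB : ∀ q ∈ BL, 2 ≤ q.1 ∧ 1 ≤ q.2 := by
    intro q hq
    obtain ⟨i, hi, rfl⟩ := List.mem_map.1 hq
    exact ⟨hn i (List.mem_range.1 hi), hk i (List.mem_range.1 hi)⟩
  have hch : BL.IsChain (fun q q' => 3 * 5 ^ (2 * q'.1) < q.2) := by
    rw [hBL, List.isChain_map, List.isChain_range]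
    intro m hm
    exact hsep (m + 1) (by omega) (by omega)
  obtain ⟨l, hl1, hl2, hl3⟩ := hRep.att
  have hF := F_list BL hB hch l hl1
  rw [hl2, hl3] at hF
  have hF2 := F_w BL
  have ew : (BL.map (fun p => ga ^ (5 ^ (2 * p.1)) * gb ^ (5 ^ (2 * p.1)) * gc ^ p.2)).prod = w := by
    rw [hBL, hw, List.map_map]; rfl
  rw [ew, hBL, List.map_map, List.map_map] at hF2
  have hs : ∀ f : ℕ → ℚ, ((List.range r).map f).sum = ∑ i ∈ Finset.range r, f i := by
    intro f
    rfl
  rw [hs, hs] at hF2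
  rw [hF2] at hF
  simp only [Function.comp] at hF
  have : ((∑ i ∈ Finset.range r, (5 ^ (2 * n i - 1) + 1) + ∑ i ∈ Finset.range r, k i : ℕ) : ℚ) ≤
      (wordLen Xgen w : ℕ) := by
    push_cast
    linarith
  exact_mod_cast this
end
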